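/- Let Z be a PMM satisfying assumptions A1 and A2, and suppose Z is positive Harris. Then there exists a constant α ∈ (0,1) such that for every s ≥ 1 there exists a σ(X_{s:∞})-measurable random variable C_s < ∞ such that for all t ≥ s ≥ l ≥ 1, almost surely sup_{n ≥ t} ‖P(Y_{t:∞} ∈ · | X_{l:n}) − P(Y_{t:∞} ∈ · | X_{s:n})‖_TV ≤ C_s α^{t−s}, where the conditional distributions of Y_{t:∞} are regular versions on the cylindrical σ-algebra of Y^∞. -/

import Mathlib

open MeasureTheory ProbabilityTheory ENNReal

namespace PMMPaper

/-! ### General Markov chain notions (general state space) -/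

section Kernels

variable {S : Type*} [MeasurableSpace S]

open Classical in
/-- `kpow κ k` is the `k`-step transition kernel of a Markov chain with one-step kernel `κ`. -/
noncomputable def kpow (κ : Kernel S S) : ℕ → Kernel S S
  | 0 => Kernel.id
  | n + 1 => kpow κ n ∘ₖ κ

/-- `φ` is an irreducibility measure for the chain with kernel `κ`:
`φ(A) > 0` implies that from every point `z` some `k`-step transition reaches `A`
with positive probability. -/
def IsIrreducibilityMeasure (κ : Kernel S S) (φ : Measure S) : Prop :=
  ∀ A : Set S, MeasurableSet A → 0 < φ A → ∀ z : S, ∃ k : ℕ, 1 ≤ k ∧ 0 < kpow κ k z A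

/-- `ψ` is a maximal irreducibility measure: a σ-finite irreducibility measure dominating
every other σ-finite irreducibility measure. -/
def IsMaxIrreducibilityMeasure (κ : Kernel S S) (ψ : Measure S) : Prop :=
  SigmaFinite ψ ∧ IsIrreducibilityMeasure κ ψ ∧
    ∀ φ : Measure S, SigmaFinite φ → IsIrreducibilityMeasure κ φ → φ ≪ ψ

/-- `Pz` is the family of laws (on the path space `ℕ → S`) of the Markov chain with
transition kernel `κ` started at the point `z`:  `Pz z` is a probability measure under which
the coordinate process starts at `z` and is Markov with kernel `κ`. -/
def IsMarkovFamily (κ : Kernel S S) (Pz : S → Measure (ℕ → S)) : Prop :=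
  (∀ z : S, IsProbabilityMeasure (Pz z)) ∧
  (∀ z : S, Pz z {ω | ω 0 = z} = 1) ∧
  ∀ (z : S) (n : ℕ) (g : S → ℝ≥0∞), Measurable g → ∀ C : Set (ℕ → S),
    MeasurableSet[⨆ i ∈ Set.Iic n, MeasurableSpace.comap (fun ω : ℕ → S => ω i) inferInstance] C →
    ∫⁻ ω in C, g (ω (n + 1)) ∂(Pz z) = ∫⁻ ω in C, ∫⁻ z', g z' ∂(κ (ω n)) ∂(Pz z)

/-- Harris recurrence property (relative to the measure `ψ`): every set charged by `ψ` is
visited infinitely often, almost surely, from every starting point. -/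
def HarrisProp (κ : Kernel S S) (Pz : S → Measure (ℕ → S)) (ψ : Measure S) : Prop :=
  ∀ A : Set S, MeasurableSet A → 0 < ψ A → ∀ z : S,
    Pz z {ω | ∀ N : ℕ, ∃ k : ℕ, N ≤ k ∧ ω k ∈ A} = 1

/-- `π` is an invariant measure for the kernel `κ`. -/
def IsInvariantMeasure (κ : Kernel S S) (π : Measure S) : Prop :=
  π.bind (fun z => κ z) = π

/-- The chain is positive: its transition kernel admits an invariant probability measure. -/
def IsPositive (κ : Kernel S S) : Prop :=
  ∃ π : Measure S, IsProbabilityMeasure π ∧ IsInvariantMeasure κ π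

/-- The process `Z` on `(Ω, P)` is a homogeneous Markov chain with transition kernel `κ`. -/
def IsMarkovChain {Ω : Type*} [MeasurableSpace Ω] (P : Measure Ω) (Z : ℕ → Ω → S)
    (κ : Kernel S S) : Prop :=
  (∀ k : ℕ, Measurable (Z k)) ∧
  ∀ (n : ℕ) (g : S → ℝ≥0∞), Measurable g → ∀ C : Set Ω,
    MeasurableSet[⨆ i ∈ Set.Iic n, MeasurableSpace.comap (Z i) inferInstance] C →
    ∫⁻ ω in C, g (Z (n + 1) ω) ∂P = ∫⁻ ω in C, ∫⁻ z', g z' ∂(κ (Z n ω)) ∂P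

/-- The process `Z : ℤ → Ω → S` on `(Ω, P)` is a (two-sided) homogeneous Markov chain
with transition kernel `κ`. -/
def IsMarkovChainZ {Ω : Type*} [MeasurableSpace Ω] (P : Measure Ω) (Z : ℤ → Ω → S)
    (κ : Kernel S S) : Prop :=
  (∀ k : ℤ, Measurable (Z k)) ∧
  ∀ (n : ℤ) (g : S → ℝ≥0∞), Measurable g → ∀ C : Set Ω,
    MeasurableSet[⨆ i ∈ Set.Iic n, MeasurableSpace.comap (Z i) inferInstance] C →
    ∫⁻ ω in C, g (Z (n + 1) ω) ∂P = ∫⁻ ω in C, ∫⁻ z', g z' ∂(κ (Z n ω)) ∂P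

/-- The reversed-time process of the two-sided chain `Z` is a Markov chain with kernel `κ'`. -/
def IsRevMarkovChainZ {Ω : Type*} [MeasurableSpace Ω] (P : Measure Ω) (Z : ℤ → Ω → S)
    (κ' : Kernel S S) : Prop :=
  ∀ (n : ℤ) (g : S → ℝ≥0∞), Measurable g → ∀ C : Set Ω,
    MeasurableSet[⨆ i ∈ Set.Ici n, MeasurableSpace.comap (Z i) inferInstance] C →
    ∫⁻ ω in C, g (Z (n - 1) ω) ∂P = ∫⁻ ω in C, ∫⁻ z', g z' ∂(κ' (Z n ω)) ∂P

/-- The two-sided process `Z` is stationary: all finite-dimensional distributions are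
invariant under time shifts. -/
def IsStationaryZ {Ω : Type*} [MeasurableSpace Ω] (P : Measure Ω) (Z : ℤ → Ω → S) : Prop :=
  ∀ (k : ℤ) (n : ℕ),
    P.map (fun ω => fun i : Fin n => Z (k + (i : ℕ)) ω) =
      P.map (fun ω => fun i : Fin n => Z ((i : ℕ) : ℤ) ω)

/-- First-coordinate projection `A_(1)` of a set of finite strings. -/
def proj1 {α : Type*} {R : ℕ} (A : Set (Fin (R + 1) → α)) : Set α :=
  (fun x => x 0) '' A

/-- The section `A(a) = {x_{2:r} : (a, x_{2:r}) ∈ A}`. -/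
def secSet {α : Type*} {R : ℕ} (A : Set (Fin (R + 1) → α)) (a : α) : Set (Fin R → α) :=
  {xr | Fin.cons a xr ∈ A}

end Kernels

/-! ### Pairwise Markov models -/

variable {𝓧 : Type*} [MeasurableSpace 𝓧] {𝓨 : Type*} [Fintype 𝓨] [DecidableEq 𝓨]
  [MeasurableSpace 𝓨] [MeasurableSingletonClass 𝓨] [Nonempty 𝓨]
  {Ω : Type*} [MeasurableSpace Ω]

/-- `Z` is a pairwise Markov model on `(Ω, P)`: a homogeneous Markov chain on `𝓧 × 𝓨`
whose transition kernel `κ` has density `q(z'|z)` with respect to `μ × count`, and whose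
initial distribution has density `p0` with respect to `μ × count`. -/
def IsPMM (P : Measure Ω) (Z : ℕ → Ω → 𝓧 × 𝓨) (κ : Kernel (𝓧 × 𝓨) (𝓧 × 𝓨))
    (μ : Measure 𝓧) (q : 𝓧 × 𝓨 → 𝓧 × 𝓨 → ℝ≥0∞) (p0 : 𝓧 × 𝓨 → ℝ≥0∞) : Prop :=
  IsProbabilityMeasure P ∧ IsMarkovChain P Z κ ∧ SigmaFinite μ ∧
  Measurable (Function.uncurry q) ∧ Measurable p0 ∧
  (∀ z : 𝓧 × 𝓨, (κ z : Measure (𝓧 × 𝓨)) =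
      (μ.prod Measure.count).withDensity (fun z' => q z' z)) ∧
  P.map (Z 0) = (μ.prod Measure.count).withDensity p0

/-- Two-sided version of `IsPMM`. -/
def IsPMMZ (P : Measure Ω) (Z : ℤ → Ω → 𝓧 × 𝓨) (κ : Kernel (𝓧 × 𝓨) (𝓧 × 𝓨))
    (μ : Measure 𝓧) (q : 𝓧 × 𝓨 → 𝓧 × 𝓨 → ℝ≥0∞) (p0 : 𝓧 × 𝓨 → ℝ≥0∞) : Prop :=
  IsProbabilityMeasure P ∧ IsMarkovChainZ P Z κ ∧ SigmaFinite μ ∧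
  Measurable (Function.uncurry q) ∧ Measurable p0 ∧
  (∀ z : 𝓧 × 𝓨, (κ z : Measure (𝓧 × 𝓨)) =
      (μ.prod Measure.count).withDensity (fun z' => q z' z)) ∧
  P.map (Z 0) = (μ.prod Measure.count).withDensity p0

/-- `pijD q x i j` is the conditional density
`p_{ij}(x_{1:r}) = p(x_{2:r}, y_r = j | x_1, y_1 = i)` (a string `x` of length `R+1`). -/
noncomputable def pijD (q : 𝓧 × 𝓨 → 𝓧 × 𝓨 → ℝ≥0∞) {R : ℕ} (x : Fin (R + 1) → 𝓧)
    (i j : 𝓨) : ℝ≥0∞ :=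
  ∑ y : Fin (R + 1) → 𝓨,
    (if y 0 = i ∧ y (Fin.last R) = j then
      ∏ k : Fin R, q (x k.succ, y k.succ) (x k.castSucc, y k.castSucc) else 0)

/-- `pmidD q x i t j` is the density `p(y_{t+1} = j, x_{2:r} | x_1, y_1 = i)`. -/
noncomputable def pmidD (q : 𝓧 × 𝓨 → 𝓧 × 𝓨 → ℝ≥0∞) {R : ℕ} (x : Fin (R + 1) → 𝓧)
    (i : 𝓨) (t : Fin (R + 1)) (j : 𝓨) : ℝ≥0∞ :=
  ∑ y : Fin (R + 1) → 𝓨,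
    (if y 0 = i ∧ y t = j then
      ∏ k : Fin R, q (x k.succ, y k.succ) (x k.castSucc, y k.castSucc) else 0)

/-- `pxD q x i = p(x_{2:r} | x_1, y_1 = i)`. -/
noncomputable def pxD (q : 𝓧 × 𝓨 → 𝓧 × 𝓨 → ℝ≥0∞) {R : ℕ} (x : Fin (R + 1) → 𝓧)
    (i : 𝓨) : ℝ≥0∞ :=
  ∑ j : 𝓨, pijD q x i j

/-- The set `Y⁺(x_{1:r}) = {(i,j) : p_{ij}(x_{1:r}) > 0}`. -/
def Yplus (q : 𝓧 × 𝓨 → 𝓧 × 𝓨 → ℝ≥0∞) {R : ℕ} (x : Fin (R + 1) → 𝓧) : Set (𝓨 × 𝓨) :=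
  {p : 𝓨 × 𝓨 | 0 < pijD q x p.1 p.2}

/-- Joint density `p(x_{1:r}, y_{1:r})` of `Z_{1:r}`, built from the initial density `p0`
and the transition density `q`. -/
noncomputable def jointD (p0 : 𝓧 × 𝓨 → ℝ≥0∞) (q : 𝓧 × 𝓨 → 𝓧 × 𝓨 → ℝ≥0∞) {R : ℕ}
    (x : Fin (R + 1) → 𝓧) (y : Fin (R + 1) → 𝓨) : ℝ≥0∞ :=
  p0 (x 0, y 0) * ∏ k : Fin R, q (x k.succ, y k.succ) (x k.castSucc, y k.castSucc)

/-- Density `p(x_{1:r})` of the observations `X_{1:r}`. -/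
noncomputable def pXD (p0 : 𝓧 × 𝓨 → ℝ≥0∞) (q : 𝓧 × 𝓨 → 𝓧 × 𝓨 → ℝ≥0∞) {R : ℕ}
    (x : Fin (R + 1) → 𝓧) : ℝ≥0∞ :=
  ∑ y : Fin (R + 1) → 𝓨, jointD p0 q x y

/-- The set `Y*(x_{1:r}) = {(y_1, y_r) : ∃ y_{2:r-1}, p(x_{1:r}, y_{1:r}) > 0}`. -/
def Ystar (p0 : 𝓧 × 𝓨 → ℝ≥0∞) (q : 𝓧 × 𝓨 → 𝓧 × 𝓨 → ℝ≥0∞) {R : ℕ}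
    (x : Fin (R + 1) → 𝓧) : Set (𝓨 × 𝓨) :=
  {p : 𝓨 × 𝓨 | ∃ y : Fin (R + 1) → 𝓨,
    y 0 = p.1 ∧ y (Fin.last R) = p.2 ∧ 0 < jointD p0 q x y}

/-- Assumption **A1**: there is `r = R + 1 > 1` and a set `E ⊆ 𝓧^r` on which
`Y⁺(x_{1:r}) = Y⁺` is constant, nonempty, and a product set. -/
def Assumption1 (q : 𝓧 × 𝓨 → 𝓧 × 𝓨 → ℝ≥0∞) {R : ℕ} (E : Set (Fin (R + 1) → 𝓧))
    (Yp : Set (𝓨 × 𝓨)) : Prop :=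
  1 ≤ R ∧ Yp.Nonempty ∧ (∀ x ∈ E, Yplus q x = Yp) ∧
    Yp = (Prod.fst '' Yp) ×ˢ (Prod.snd '' Yp)

/-- Assumption **A2**: `ψ` is a maximal irreducibility measure for the chain,
`ψ(E_(1) × Y⁺_(1)) > 0` and `μ^{r-1}(E(x₁)) > 0` for all `x₁ ∈ E_(1)`. -/
def Assumption2 (κ : Kernel (𝓧 × 𝓨) (𝓧 × 𝓨)) (ψ : Measure (𝓧 × 𝓨)) (μ : Measure 𝓧)
    {R : ℕ} (E : Set (Fin (R + 1) → 𝓧)) (Yp : Set (𝓨 × 𝓨)) : Prop :=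
  IsMaxIrreducibilityMeasure κ ψ ∧
  0 < ψ (proj1 E ×ˢ (Prod.fst '' Yp)) ∧
  ∀ x₁ ∈ proj1 E, 0 < (Measure.pi fun _ : Fin R => μ) (secSet E x₁)

/-- Assumption **A1'** (stationary case): `Y*(x_{1:r}) = Y*` is constant on `E`,
nonempty and a product set. -/
def Assumption1' (p0 : 𝓧 × 𝓨 → ℝ≥0∞) (q : 𝓧 × 𝓨 → 𝓧 × 𝓨 → ℝ≥0∞) {R : ℕ}
    (E : Set (Fin (R + 1) → 𝓧)) (Ys : Set (𝓨 × 𝓨)) : Prop :=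
  1 ≤ R ∧ Ys.Nonempty ∧ (∀ x ∈ E, Ystar p0 q x = Ys) ∧
    Ys = (Prod.fst '' Ys) ×ˢ (Prod.snd '' Ys)

/-- Assumption **A2'**: `μ^r(E) > 0`. -/
def Assumption2' (μ : Measure 𝓧) {R : ℕ} (E : Set (Fin (R + 1) → 𝓧)) : Prop :=
  0 < (Measure.pi fun _ : Fin (R + 1) => μ) E

/-! ### Smoothing distributions -/

/-- The σ-algebra `σ(X_{l:n})` generated by the observations with indices in `[l, n]`. -/
noncomputable def obsSigma (Z : ℕ → Ω → 𝓧 × 𝓨) (l n : ℕ) : MeasurableSpace Ω :=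
  ⨆ i ∈ Set.Icc l n, MeasurableSpace.comap (fun ω => (Z i ω).1) inferInstance

/-- The σ-algebra `σ(X_{s:∞})` generated by the observations with indices `≥ s`. -/
noncomputable def obsSigmaFrom (Z : ℕ → Ω → 𝓧 × 𝓨) (s : ℕ) : MeasurableSpace Ω :=
  ⨆ i ∈ Set.Ici s, MeasurableSpace.comap (fun ω => (Z i ω).1) inferInstance

/-- The smoothing probability `ν^t_{l:n;m}(v) = P(Y_{t:t+m-1} = v | X_{l:n})`,
realized as a conditional expectation of an indicator. -/
noncomputable def smooth (P : Measure Ω) (Z : ℕ → Ω → 𝓧 × 𝓨) (t l n : ℕ) {m : ℕ}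
    (v : Fin m → 𝓨) : Ω → ℝ :=
  P[Set.indicator {ω | ∀ i : Fin m, (Z (t + (i : ℕ)) ω).2 = v i} (fun _ => (1 : ℝ)) |
    obsSigma Z l n]

/-- Total variation distance `‖ν^t_{l:n;m} − ν^t_{s:n;m}‖_TV`. -/
noncomputable def tvBlock (P : Measure Ω) (Z : ℕ → Ω → 𝓧 × 𝓨) (t l s n m : ℕ) (ω : Ω) : ℝ :=
  ∑ v : Fin m → 𝓨, |smooth P Z t l n v ω - smooth P Z t s n v ω|

/-- Two-sided version: the σ-algebra `σ(X_i ; i ∈ I)` for `I ⊆ ℤ`. -/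
noncomputable def obsSigmaZ (Z : ℤ → Ω → 𝓧 × 𝓨) (I : Set ℤ) : MeasurableSpace Ω :=
  ⨆ i ∈ I, MeasurableSpace.comap (fun ω => (Z i ω).1) inferInstance

/-- Two-sided smoothing probability `P(Y_{t:t+m-1} = v | X_i ; i ∈ I)`. -/
noncomputable def smoothZ (P : Measure Ω) (Z : ℤ → Ω → 𝓧 × 𝓨) (t : ℤ) (I : Set ℤ) {m : ℕ}
    (v : Fin m → 𝓨) : Ω → ℝ :=
  P[Set.indicator {ω | ∀ i : Fin m, (Z (t + (i : ℕ)) ω).2 = v i} (fun _ => (1 : ℝ)) |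
    obsSigmaZ Z I]

/-- Two-sided total variation distance between smoothing distributions with observation
index sets `I` and `J`. -/
noncomputable def tvBlockZ (P : Measure Ω) (Z : ℤ → Ω → 𝓧 × 𝓨) (t : ℤ) (I J : Set ℤ)
    (m : ℕ) (ω : Ω) : ℝ :=
  ∑ v : Fin m → 𝓨, |smoothZ P Z t I v ω - smoothZ P Z t J v ω|

/-! ### Counters, Doeblin matrices -/

/-- `κ_k(X_{s:t})`: the number of (almost non-overlapping) `E`-blocks of length `R+1`
in the observed string, counting from position `s + k` (paper's `κ_k`, `r' = R`). -/
noncomputable def kapCount (Z : ℕ → Ω → 𝓧 × 𝓨) {R : ℕ} (E : Set (Fin (R + 1) → 𝓧))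
    (s t kk : ℕ) (ω : Ω) : ℕ :=
  ∑ u ∈ Finset.range ((t - kk - s) / R),
    Set.indicator E (fun _ => 1) (fun i : Fin (R + 1) => (Z (u * R + s + kk + (i : ℕ)) ω).1)

/-- `κ̄(X_{s:t})`: the backward counter, counting `E`-blocks from position `t` backwards. -/
noncomputable def kapBar (Z : ℕ → Ω → 𝓧 × 𝓨) {R : ℕ} (E : Set (Fin (R + 1) → 𝓧))
    (s t : ℕ) (ω : Ω) : ℕ :=
  ∑ u ∈ Finset.range ((t - s) / R),
    Set.indicator E (fun _ => 1) (fun i : Fin (R + 1) => (Z (t - (u + 1) * R + (i : ℕ)) ω).1)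

open Classical in
/-- The segment `x_{a+1:b+1}` (0-based indices `a..b`) of a string of length `L+1`. -/
def segv {L : ℕ} (x : Fin (L + 1) → 𝓧) (a b : ℕ) (hab : a ≤ b) (hb : b ≤ L) :
    Fin (b - a + 1) → 𝓧 :=
  fun i => x ⟨a + (i : ℕ), by omega⟩

/-- Normalizing constant `c(x_{r:n}) = ∑_{j ∈ Y₂} p(x_{r+1:n} | x_r, y_r = j)`. -/
noncomputable def normC (q : 𝓧 × 𝓨 → 𝓧 × 𝓨 → ℝ≥0∞) (Y2 : Set 𝓨) {M : ℕ}
    (w : Fin (M + 1) → 𝓧) : ℝ≥0∞ :=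
  ∑ j : 𝓨, Set.indicator Y2 (fun j' => pxD q w j') j

/-- The probability vector `λ[x_{r:n}](j)`. -/
noncomputable def lamD (q : 𝓧 × 𝓨 → 𝓧 × 𝓨 → ℝ≥0∞) (Y2 : Set 𝓨) {M : ℕ}
    (w : Fin (M + 1) → 𝓧) (j : 𝓨) : ℝ≥0∞ :=
  Set.indicator Y2 (fun j' => pxD q w j') j / normC q Y2 w

/-- The matrix `U[x_{1:n}](i,j)`; a version of `P(Y_r = j | X_{1:n} = x_{1:n}, Y_1 = i)`. -/
noncomputable def UMat (q : 𝓧 × 𝓨 → 𝓧 × 𝓨 → ℝ≥0∞) (Y2 : Set 𝓨) {L R : ℕ} (hR : R ≤ L)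
    (x : Fin (L + 1) → 𝓧) (i j : 𝓨) : ℝ≥0∞ :=
  if 0 < pxD q x i then pmidD q x i ⟨R, by omega⟩ j / pxD q x i
  else lamD q Y2 (segv x R L hR (le_refl L)) j

/-! ### Total variation of measures, conditional laws of `Y_{t:∞}` -/

open Classical in
/-- Total variation distance between two measures (normalized as in the paper:
`‖P − Q‖_TV = 2 sup_A |P(A) − Q(A)|`). -/
noncomputable def tvDistM {W : Type*} [MeasurableSpace W] (ρ₁ ρ₂ : Measure W) : ℝ≥0∞ :=
  2 * ⨆ (A : Set W) (_ : MeasurableSet A), ((ρ₁ A - ρ₂ A) ⊔ (ρ₂ A - ρ₁ A))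

/-- The observation vector `X_{l:n}`. -/
def obsVec (Z : ℕ → Ω → 𝓧 × 𝓨) (l n : ℕ) (ω : Ω) : Fin (n + 1 - l) → 𝓧 :=
  fun i => (Z (l + (i : ℕ)) ω).1

/-- The tail signal process `Y_{t:∞}`. -/
def tailY (Z : ℕ → Ω → 𝓧 × 𝓨) (t : ℕ) (ω : Ω) : ℕ → 𝓨 :=
  fun k => (Z (t + k) ω).2

/-- The observation tail `X_{l:∞}`. -/
def obsTail (Z : ℕ → Ω → 𝓧 × 𝓨) (l : ℕ) (ω : Ω) : ℕ → 𝓧 :=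
  fun k => (Z (l + k) ω).1

/-- A regular version of the conditional distribution `P(Y_{t:∞} ∈ · | X_{l:n})`,
evaluated at `ω`. -/
noncomputable def condLawTail (P : Measure Ω) [IsFiniteMeasure P] (Z : ℕ → Ω → 𝓧 × 𝓨)
    (t l n : ℕ) (ω : Ω) : Measure (ℕ → 𝓨) :=
  condDistrib (tailY Z t) (obsVec Z l n) P (obsVec Z l n ω)

/-- A regular version of the conditional distribution `P(Y_{t:∞} ∈ · | X_{l:∞})`,
evaluated at `ω`. -/
noncomputable def condLawTailInf (P : Measure Ω) [IsFiniteMeasure P] (Z : ℕ → Ω → 𝓧 × 𝓨)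
    (t l : ℕ) (ω : Ω) : Measure (ℕ → 𝓨) :=
  condDistrib (tailY Z t) (obsTail Z l) P (obsTail Z l ω)

/-! ### Hidden Markov models and matrices -/

/-- Powers of a nonnegative matrix on `𝓨`. -/
noncomputable def matpow (p : 𝓨 → 𝓨 → ℝ≥0∞) : ℕ → 𝓨 → 𝓨 → ℝ≥0∞
  | 0 => fun i j => if i = j then 1 else 0
  | n + 1 => fun i j => ∑ k : 𝓨, matpow p n i k * p k j

/-- The sub-matrix `ℙ_C` of `p` with rows and columns restricted to `C` (and `0` outside). -/
noncomputable def subMat (p : 𝓨 → 𝓨 → ℝ≥0∞) (C : Set 𝓨) : 𝓨 → 𝓨 → ℝ≥0∞ :=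
  fun i j => Set.indicator (C ×ˢ C) (fun ij : 𝓨 × 𝓨 => p ij.1 ij.2) (i, j)

/-- Support `G_i = {x : f_i(x) > 0}` of the emission density `f_i`. -/
def emisSupp (f : 𝓨 → 𝓧 → ℝ≥0∞) (i : 𝓨) : Set 𝓧 :=
  {x | 0 < f i x}

/-- `C` is a cluster: `μ[(∩_{i∈C} G_i) \ (∪_{i∉C} G_i)] > 0`. -/
def IsCluster (μ : Measure 𝓧) (f : 𝓨 → 𝓧 → ℝ≥0∞) (C : Set 𝓨) : Prop :=
  0 < μ ((⋂ i ∈ C, emisSupp f i) \ (⋃ i ∈ Cᶜ, emisSupp f i))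

section Helpers

section PathMachinery

variable {S : Type*} [MeasurableSpace S]

/-- Prepend a letter to a sequence. -/
def scons {α : Type*} (a : α) (x : ℕ → α) : ℕ → α
  | 0 => a
  | k + 1 => x k

/-- Shift a sequence. -/
def sh {α : Type*} (u : ℕ) (x : ℕ → α) : ℕ → α := fun k => x (u + k)

@[simp] lemma scons_zero {α : Type*} (a : α) (x : ℕ → α) : scons a x 0 = a := rfl
@[simp] lemma scons_succ {α : Type*} (a : α) (x : ℕ → α) (k : ℕ) : scons a x (k + 1) = x k := rfl
lemma sh_apply {α : Type*} (u : ℕ) (x : ℕ → α) (k : ℕ) : sh u x k = x (u + k) := rfl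
@[simp] lemma sh_one_scons {α : Type*} (a : α) (x : ℕ → α) : sh 1 (scons a x) = x := by
  funext k; rw [sh_apply, Nat.add_comm]; rfl
@[simp] lemma sh_zero {α : Type*} (x : ℕ → α) : sh 0 x = x := by
  funext k; simp [sh_apply]
lemma sh_sh {α : Type*} (u v : ℕ) (x : ℕ → α) : sh u (sh v x) = sh (v + u) x := by
  funext k; simp [sh_apply, Nat.add_assoc]
lemma scons_sh {α : Type*} (x : ℕ → α) : scons (x 0) (sh 1 x) = x := by
  funext k
  cases k with
  | zero => rfl
  | succ k => simp [sh_apply, Nat.add_comm]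
lemma sh_succ_scons {α : Type*} (u : ℕ) (a : α) (x : ℕ → α) : sh (u + 1) (scons a x) = sh u x := by
  rw [Nat.add_comm, ← sh_sh, sh_one_scons]

lemma measurable_sh {α : Type*} [MeasurableSpace α] (u : ℕ) :
    Measurable (sh u : (ℕ → α) → (ℕ → α)) :=
  measurable_pi_lambda _ fun _ => measurable_pi_apply _

lemma measurable_scons {α : Type*} [MeasurableSpace α] :
    Measurable (fun p : α × (ℕ → α) => scons p.1 p.2) := by
  refine measurable_pi_lambda _ fun k => ?_
  cases k with
  | zero => exact measurable_fst
  | succ k => exact (measurable_pi_apply k).comp measurable_snd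

open Classical in
/-- probability of a rectangle cylinder started from `z` -/
noncomputable def cylQ (κ : Kernel S S) : ℕ → (ℕ → Set S) → S → ℝ≥0∞
  | 0, f => fun z => (f 0).indicator (fun _ => 1) z
  | m + 1, f => fun z => (f 0).indicator (fun z => ∫⁻ z', cylQ κ m (sh 1 f) z' ∂(κ z)) z

lemma measurable_cylQ (κ : Kernel S S) (m : ℕ) : ∀ (f : ℕ → Set S),
    (∀ k, MeasurableSet (f k)) → Measurable (cylQ κ m f) := by
  induction m with
  | zero => intro f hf; exact measurable_const.indicator (hf 0)
  | succ m ih =>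
    intro f hf
    exact ((ih (sh 1 f) (fun k => hf _)).lintegral_kernel).indicator (hf 0)

set_option linter.unusedSectionVars false

variable {Ω' : Type*} [mΩ : MeasurableSpace Ω']

/-- natural past sigma-algebra -/
noncomputable abbrev pastSigma (W : ℕ → Ω' → S) (n : ℕ) : MeasurableSpace Ω' :=
  ⨆ i ∈ Set.Iic n, MeasurableSpace.comap (W i) inferInstance

lemma pastSigma_mono (W : ℕ → Ω' → S) {n m : ℕ} (h : n ≤ m) : pastSigma W n ≤ pastSigma W m := by
  refine iSup₂_le fun i hi => ?_
  exact le_iSup₂_of_le i (le_trans hi h) le_rfl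

lemma measurable_pastSigma (W : ℕ → Ω' → S) {n m : ℕ} (h : n ≤ m) :
    Measurable[pastSigma W m] (W n) := by
  refine Measurable.of_comap_le ?_
  exact le_iSup₂_of_le (f := fun i (_ : i ∈ Set.Iic m) => MeasurableSpace.comap (W i) inferInstance)
    n h le_rfl

lemma pastSigma_le (W : ℕ → Ω' → S) (hW : ∀ k, Measurable (W k)) (n : ℕ) :
    pastSigma W n ≤ mΩ :=
  iSup₂_le fun i _ => (hW i).comap_le

lemma markov_cyl {P : Measure Ω'} {W : ℕ → Ω' → S} {κ : Kernel S S} (h : IsMarkovChain P W κ)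
    (m : ℕ) : ∀ (f : ℕ → Set S), (∀ k, MeasurableSet (f k)) → ∀ (n : ℕ) (C : Set Ω'),
    MeasurableSet[pastSigma W n] C →
    P (C ∩ {ω | ∀ k ≤ m, W (n + k) ω ∈ f k}) = ∫⁻ ω in C, cylQ κ m f (W n ω) ∂P := by
  obtain ⟨hW, hM⟩ := h
  induction m with
  | zero =>
    intro f hf n C hC
    have hC' : MeasurableSet C := pastSigma_le W hW n C hC
    have e : (fun ω => cylQ κ 0 f (W n ω)) = ((W n) ⁻¹' (f 0)).indicator 1 := by
      funext ω
      by_cases hω : W n ω ∈ f 0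
      · rw [Set.indicator_of_mem (show ω ∈ W n ⁻¹' f 0 from hω)]
        simp [cylQ, hω]
      · rw [Set.indicator_of_notMem (show ω ∉ W n ⁻¹' f 0 from hω)]
        simp [cylQ, hω]
    rw [e, lintegral_indicator_one (hW n (hf 0)), Measure.restrict_apply (hW n (hf 0)),
      Set.inter_comm]
    congr 1; ext ω; simp
  | succ m ih =>
    intro f hf n C hC
    have hC' : MeasurableSet C := pastSigma_le W hW n C hC
    have hD : MeasurableSet[pastSigma W n] (C ∩ (W n) ⁻¹' (f 0)) :=
      hC.inter (measurable_pastSigma W le_rfl (hf 0))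
    have hD1 := pastSigma_mono W (Nat.le_succ n) _ hD
    have := ih (sh 1 f) (fun k => hf _) (n + 1) _ hD1
    have e1 : C ∩ {ω | ∀ k ≤ m + 1, W (n + k) ω ∈ f k} =
        (C ∩ (W n) ⁻¹' (f 0)) ∩ {ω | ∀ k ≤ m, W (n + 1 + k) ω ∈ sh 1 f k} := by
      ext ω
      constructor
      · rintro ⟨h1, h2⟩
        refine ⟨⟨h1, h2 0 (Nat.zero_le _)⟩, fun k hk => ?_⟩
        have := h2 (1 + k) (by omega)
        rwa [← Nat.add_assoc] at this
      · rintro ⟨⟨h1, h2⟩, h3⟩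
        refine ⟨h1, fun k hk => ?_⟩
        cases k with
        | zero => exact h2
        | succ k =>
          have := h3 k (by omega)
          rw [sh_apply, Nat.add_comm 1 k] at this
          rwa [show n + (k + 1) = n + 1 + k by omega]
    rw [e1, this, hM n _ (measurable_cylQ κ m (sh 1 f) (fun k => hf _)) _ hD]
    rw [Set.inter_comm, ← Measure.restrict_restrict (hW n (hf 0)),
      ← lintegral_indicator (hW n (hf 0))]
    rfl

lemma squareCyl_eq {s : Finset ℕ} {t : ℕ → Set S} (ht : ∀ k, MeasurableSet (t k)) :
    ∃ (m : ℕ) (f : ℕ → Set S), (∀ k, MeasurableSet (f k)) ∧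
      (s : Set ℕ).pi t = {ω | ∀ k ≤ m, ω k ∈ f k} := by
  classical
  refine ⟨s.sup id, fun k => if k ∈ s then t k else Set.univ, fun k => ?_, ?_⟩
  · dsimp only
    split_ifs
    · exact ht k
    · exact MeasurableSet.univ
  · ext ω
    constructor
    · intro h k _
      by_cases hk : k ∈ s
      · simpa [hk] using h k hk
      · simp [hk]
    · intro h k hk
      have hk' : k ∈ s := hk
      have := h k (Finset.le_sup (f := id) hk')
      simpa [hk'] using this

lemma cyl_pi : IsPiSystem (squareCylinders fun _ : ℕ => {s : Set S | MeasurableSet s}) :=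
  isPiSystem_squareCylinders (fun _ => MeasurableSpace.isPiSystem_measurableSet)
    (fun _ => MeasurableSet.univ)

lemma pathMeasure_ext {μ ν : Measure (ℕ → S)} [IsFiniteMeasure μ]
    (h : ∀ m (f : ℕ → Set S), (∀ k, MeasurableSet (f k)) →
      μ {ω | ∀ k ≤ m, ω k ∈ f k} = ν {ω | ∀ k ≤ m, ω k ∈ f k}) : μ = ν := by
  refine ext_of_generate_finite _ generateFrom_squareCylinders.symm cyl_pi ?_ ?_
  · rintro _ ⟨s, t, ht, rfl⟩
    obtain ⟨m, f, hf, e⟩ := squareCyl_eq (s := s) (t := t) (fun k => ht k trivial)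
    rw [e]; exact h m f hf
  · have := h 0 (fun _ => Set.univ) (fun _ => MeasurableSet.univ)
    simpa using this

/-- coordinate chain of the family -/
lemma family_chain {κ : Kernel S S} {Pz : S → Measure (ℕ → S)} (h : IsMarkovFamily κ Pz) (z : S) :
    IsMarkovChain (Pz z) (fun k ω => ω k) κ :=
  ⟨fun k => measurable_pi_apply k, fun n g hg C hC => h.2.2 z n g hg C hC⟩

variable [MeasurableSingletonClass S]

lemma family_start {κ : Kernel S S} {Pz : S → Measure (ℕ → S)} (h : IsMarkovFamily κ Pz) (z : S) :
    ∀ᵐ ω ∂(Pz z), ω 0 = z := by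
  have := h.1 z
  have hm : MeasurableSet {ω : ℕ → S | ω 0 = z} :=
    (measurable_pi_apply (X := fun _ : ℕ => S) 0) (measurableSet_singleton z)
  exact (mem_ae_iff_prob_eq_one hm).2 (h.2.1 z)

lemma family_cyl {κ : Kernel S S} {Pz : S → Measure (ℕ → S)} (h : IsMarkovFamily κ Pz) (z : S)
    (m : ℕ) (f : ℕ → Set S) (hf : ∀ k, MeasurableSet (f k)) :
    Pz z {ω | ∀ k ≤ m, ω k ∈ f k} = cylQ κ m f z := by
  have := h.1 z
  have h1 := markov_cyl (family_chain h z) m f hf 0 Set.univ MeasurableSet.univ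
  simp only [Set.univ_inter, Nat.zero_add, Measure.restrict_univ] at h1
  rw [h1]
  have : ∫⁻ ω, cylQ κ m f (ω 0) ∂(Pz z) = ∫⁻ _, cylQ κ m f z ∂(Pz z) :=
    lintegral_congr_ae ((family_start h z).mono fun ω hω => by simp [hω])
  rw [this]; simp

lemma family_measurable {κ : Kernel S S} {Pz : S → Measure (ℕ → S)} (h : IsMarkovFamily κ Pz) :
    Measurable Pz := by
  have := h.1
  refine Measurable.measure_of_isPiSystem_of_isProbabilityMeasure
    generateFrom_squareCylinders.symm cyl_pi ?_
  rintro _ ⟨s, t, ht, rfl⟩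
  obtain ⟨m, f, hf, e⟩ := squareCyl_eq (s := s) (t := t) (fun k => ht k trivial)
  simp_rw [e, family_cyl h _ m f hf]
  exact measurable_cylQ κ m f hf

/-- the path kernel -/
noncomputable def pathK {κ : Kernel S S} {Pz : S → Measure (ℕ → S)} (h : IsMarkovFamily κ Pz) :
    Kernel S (ℕ → S) := ⟨Pz, family_measurable h⟩

instance {κ : Kernel S S} {Pz : S → Measure (ℕ → S)} (h : IsMarkovFamily κ Pz) :
    IsMarkovKernel (pathK h) := ⟨h.1⟩

lemma pathK_apply {κ : Kernel S S} {Pz : S → Measure (ℕ → S)} (h : IsMarkovFamily κ Pz) (z : S) :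
    pathK h z = Pz z := rfl

/-- Markov property for path events. -/
lemma markov_path {P : Measure Ω'} [IsFiniteMeasure P] {W : ℕ → Ω' → S} {κ : Kernel S S}
    {Pz : S → Measure (ℕ → S)} (hF : IsMarkovFamily κ Pz)
    (h : IsMarkovChain P W κ) (n : ℕ) (C : Set Ω') (hC : MeasurableSet[pastSigma W n] C) :
    (P.restrict C).map (fun ω k => W (n + k) ω) = ((P.restrict C).map (W n)).bind (pathK hF) := by
  have hm : Measurable (fun ω k => W (n + k) ω) := measurable_pi_lambda _ fun k => h.1 _
  refine pathMeasure_ext fun m f hf => ?_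
  have hms : MeasurableSet {ω : ℕ → S | ∀ k ≤ m, ω k ∈ f k} := by
    have : {ω : ℕ → S | ∀ k ≤ m, ω k ∈ f k} = (Set.Iic m).pi f := by
      ext ω; simp [Set.pi]
    rw [this]
    exact MeasurableSet.pi (Set.to_countable _) (fun k _ => hf k)
  have hC' : MeasurableSet C := pastSigma_le W h.1 n C hC
  rw [Measure.map_apply hm hms, Measure.bind_apply hms (pathK hF).measurable.aemeasurable,
    lintegral_map ((pathK hF).measurable_coe hms) (h.1 n), Measure.restrict_apply (hm hms)]
  simp_rw [pathK_apply, family_cyl hF _ m f hf]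
  rw [← markov_cyl h m f hf n C hC, Set.inter_comm]
  rfl

end PathMachinery

section PathMachinery2

set_option linter.unusedSectionVars false

variable {S : Type*} [MeasurableSpace S] [MeasurableSingletonClass S]
  {Ω' : Type*} [mΩ : MeasurableSpace Ω']

/-- the stopped past -/
def pastP (W : ℕ → Ω' → S) (s : ℕ) (ω : Ω') : ℕ → S := fun k => W (min k s) ω

lemma measurable_pastP (W : ℕ → Ω' → S) (s : ℕ) : Measurable[pastSigma W s] (pastP W s) := by
  refine @measurable_pi_lambda _ _ _ (pastSigma W s) _ _ fun k => ?_
  exact measurable_pastSigma W (min_le_right k s)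

/-- Markov property for functionals of the past and the future. -/
lemma markov_joint {P : Measure Ω'} [IsFiniteMeasure P] {W : ℕ → Ω' → S} {κ : Kernel S S}
    {Pz : S → Measure (ℕ → S)} (hF : IsMarkovFamily κ Pz)
    (h : IsMarkovChain P W κ) (s : ℕ) (G : (ℕ → S) → (ℕ → S) → ℝ≥0∞)
    (hG : Measurable (Function.uncurry G)) :
    ∫⁻ ω, G (pastP W s ω) (fun k => W (s + k) ω) ∂P
      = ∫⁻ ω, ∫⁻ ω', G (pastP W s ω) ω' ∂(Pz (W s ω)) ∂P := by
  have hm : Measurable (fun ω k => W (s + k) ω) := measurable_pi_lambda _ fun k => h.1 _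
  have hp : Measurable (pastP W s) := measurable_pi_lambda _ fun k => h.1 _
  have hl : Measurable (fun p : ℕ → S => p s) := measurable_pi_apply s
  have key : P.map (fun ω => (pastP W s ω, (fun k => W (s + k) ω : ℕ → S)))
      = (P.map (pastP W s)) ⊗ₘ ((pathK hF).comap (fun p : ℕ → S => p s) hl) := by
    refine Measure.ext_prod fun {C D} hC hD => ?_
    have hC' : MeasurableSet[pastSigma W s] (pastP W s ⁻¹' C) := measurable_pastP W s hC
    have h1 := congrArg (fun ν => ν D) (markov_path hF h s _ hC')
    rw [Measure.map_apply (hp.prodMk hm) (hC.prod hD), Measure.compProd_apply_prod hC hD,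
      setLIntegral_map hC (Kernel.measurable_coe _ hD) hp]
    rw [Measure.map_apply hm hD, Measure.bind_apply hD (pathK hF).measurable.aemeasurable,
      lintegral_map ((pathK hF).measurable_coe hD) (h.1 s), Measure.restrict_apply (hm hD)] at h1
    have e : (fun ω => (pastP W s ω, (fun k => W (s + k) ω : ℕ → S))) ⁻¹' (C ×ˢ D)
      = (fun ω k => W (s + k) ω) ⁻¹' D ∩ pastP W s ⁻¹' C := by
      ext ω; simp [and_comm]
    rw [e, h1]
    simp [Kernel.comap_apply, pastP]
  have h2 : ∫⁻ ω, G (pastP W s ω) (fun k => W (s + k) ω) ∂P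
     = ∫⁻ x, Function.uncurry G x ∂(P.map (fun ω => (pastP W s ω, (fun k => W (s + k) ω : ℕ → S)))) := by
    rw [lintegral_map hG (hp.prodMk hm)]; rfl
  rw [h2, key, Measure.lintegral_compProd hG, lintegral_map ?_ hp]
  · simp [Kernel.comap_apply, pastP, pathK_apply, Function.uncurry]
  · exact hG.lintegral_kernel_prod_right'

lemma markov_lintegral {P : Measure Ω'} [IsFiniteMeasure P] {W : ℕ → Ω' → S} {κ : Kernel S S}
    {Pz : S → Measure (ℕ → S)} (hF : IsMarkovFamily κ Pz)
    (h : IsMarkovChain P W κ) (n : ℕ) (G : (ℕ → S) → ℝ≥0∞) (hG : Measurable G) :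
    ∫⁻ ω, G (fun k => W (n + k) ω) ∂P = ∫⁻ ω, ∫⁻ ω', G ω' ∂(Pz (W n ω)) ∂P :=
  markov_joint hF h n (fun _ ω' => G ω') (hG.comp measurable_snd)

lemma family_map_one {κ : Kernel S S} {Pz : S → Measure (ℕ → S)} (hF : IsMarkovFamily κ Pz)
    (z : S) (g : S → ℝ≥0∞) (hg : Measurable g) :
    ∫⁻ ω, g (ω 1) ∂(Pz z) = ∫⁻ z', g z' ∂(κ z) := by
  have := hF.1 z
  have h1 := hF.2.2 z 0 g hg Set.univ MeasurableSet.univ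
  simp only [Measure.restrict_univ, Nat.zero_add] at h1
  rw [h1, lintegral_congr_ae ((family_start hF z).mono fun ω hω =>
    show _ = ∫⁻ z', g z' ∂(κ z) by simp [hω])]
  simp

lemma family_kernel_markov {κ : Kernel S S} {Pz : S → Measure (ℕ → S)}
    (hF : IsMarkovFamily κ Pz) : IsMarkovKernel κ := by
  refine ⟨fun z => ⟨?_⟩⟩
  have := hF.1 z
  have := family_map_one hF z (fun _ => 1) measurable_const
  simpa using this.symm

lemma family_first_step {κ : Kernel S S} {Pz : S → Measure (ℕ → S)} (hF : IsMarkovFamily κ Pz)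
    (z : S) (G : (ℕ → S) → ℝ≥0∞) (hG : Measurable G) :
    ∫⁻ ω, G ω ∂(Pz z) = ∫⁻ z', ∫⁻ ω', G (scons z ω') ∂(Pz z') ∂(κ z) := by
  have := hF.1 z
  have hm : Measurable (fun ω' : ℕ → S => G (scons z ω')) :=
    hG.comp (measurable_scons.comp (measurable_const.prodMk measurable_id))
  have h1 := markov_lintegral hF (family_chain hF z) 1 (fun ω' => G (scons z ω')) hm
  rw [family_map_one hF z (fun z' => ∫⁻ ω', G (scons z ω') ∂(Pz z'))
    (hm.lintegral_kernel (κ := pathK hF))] at h1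
  rw [← h1]
  refine lintegral_congr_ae ((family_start hF z).mono fun ω hω => ?_)
  have : scons z (fun k => ω (1 + k)) = ω := by
    rw [← hω]; exact scons_sh ω
  simp only [this]

/-- Lévy + Markov: for an invariant event `J`, `Pz(J)` evaluated along the path converges
to the indicator of `J`. -/
lemma levy_invariant {κ : Kernel S S} {Pz : S → Measure (ℕ → S)} (hF : IsMarkovFamily κ Pz)
    (J : Set (ℕ → S)) (hJ : MeasurableSet J) (hinv : ∀ n ω, sh n ω ∈ J ↔ ω ∈ J) (z : S) :
    ∀ᵐ ω ∂(Pz z), Filter.Tendsto (fun n => (Pz (ω n) J).toReal) Filter.atTop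
      (nhds (J.indicator (fun _ => (1 : ℝ)) ω)) := by
  have hp := hF.1
  let W : ℕ → (ℕ → S) → S := fun k ω => ω k
  have hW : ∀ k, Measurable (W k) := fun k => measurable_pi_apply k
  let ℱ : Filtration ℕ (inferInstance : MeasurableSpace (ℕ → S)) :=
    { seq := fun n => pastSigma W n
      mono' := fun _ _ h => pastSigma_mono W h
      le' := fun n => pastSigma_le W hW n }
  have hsup : (⨆ n, ℱ n) = (inferInstance : MeasurableSpace (ℕ → S)) := by
    apply le_antisymm
    · exact iSup_le fun n => ℱ.le n
    · refine iSup_le fun i => ?_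
      have h1 : MeasurableSpace.comap (W i) inferInstance ≤ ℱ i :=
        (measurable_pastSigma W le_rfl).comap_le
      exact h1.trans (le_iSup (fun n => (ℱ n : MeasurableSpace (ℕ → S))) i)
  have hmeasJ : Measurable (fun z => Pz z J) := (pathK hF).measurable_coe hJ
  have hintg : Integrable (J.indicator (fun _ => (1 : ℝ))) (Pz z) :=
    (integrable_const 1).indicator hJ
  have hcond : ∀ n, (Pz z)[J.indicator (fun _ => (1 : ℝ)) | ℱ n]
      =ᵐ[Pz z] fun ω => (Pz (ω n) J).toReal := by
    intro n
    symm
    refine ae_eq_condExp_of_forall_setIntegral_eq (ℱ.le n) hintg ?_ ?_ ?_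
    · intro s _ _
      refine (Integrable.of_bound (C := 1) ?_ ?_).integrableOn
      · exact ((hmeasJ.ennreal_toReal).comp (hW n)).aestronglyMeasurable
      · refine Filter.Eventually.of_forall fun ω => ?_
        simp only [Real.norm_eq_abs, abs_of_nonneg ENNReal.toReal_nonneg]
        exact measureReal_le_one
    · intro s hs _
      have hs' : MeasurableSet s := ℱ.le n s hs
      have h1 := congrArg (fun ν => ν J) (markov_path hF (family_chain hF z) n s hs)
      have hm : Measurable (fun (ω : ℕ → S) k => ω (n + k)) := measurable_sh n
      rw [Measure.map_apply hm hJ, Measure.bind_apply hJ (pathK hF).measurable.aemeasurable,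
        lintegral_map ((pathK hF).measurable_coe hJ) (hW n), Measure.restrict_apply (hm hJ)] at h1
      have e : (fun (ω : ℕ → S) k => ω (n + k)) ⁻¹' J = J := by
        ext ω; exact hinv n ω
      rw [e] at h1
      have h2 : ∫⁻ ω in s, Pz (ω n) J ∂(Pz z) = Pz z (J ∩ s) := h1.symm
      have hma : AEMeasurable (fun ω : ℕ → S => Pz (ω n) J) ((Pz z).restrict s) :=
        (hmeasJ.comp (hW n)).aemeasurable
      rw [integral_toReal hma
        (Filter.Eventually.of_forall fun ω => measure_lt_top _ _),
        integral_indicator hJ, h2]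
      simp [Measure.real, hJ]
    · have : Measurable[ℱ n] (fun ω : ℕ → S => (Pz (ω n) J).toReal) :=
        (hmeasJ.ennreal_toReal).comp (measurable_pastSigma W le_rfl)
      exact this.stronglyMeasurable.aestronglyMeasurable
  have hlim := tendsto_ae_condExp (μ := Pz z) (ℱ := ℱ) (J.indicator (fun _ => (1 : ℝ)))
  rw [hsup, condExp_of_stronglyMeasurable le_rfl
    (stronglyMeasurable_const.indicator hJ) hintg] at hlim
  filter_upwards [hlim, ae_all_iff.2 hcond] with ω h1 h2
  exact h1.congr fun n => h2 n

end PathMachinery2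

section Maximal

set_option linter.unusedSectionVars false

variable {A : Type*} [MeasurableSpace A]

/-- running maxima of Birkhoff sums -/
noncomputable def runMax (T : A → A) (f : A → ℝ) : ℕ → A → ℝ
  | 0 => fun _ => 0
  | n + 1 => fun x => max 0 (f x + runMax T f n (T x))

lemma runMax_nonneg (T : A → A) (f : A → ℝ) (n : ℕ) (x : A) : 0 ≤ runMax T f n x := by
  cases n with
  | zero => exact le_rfl
  | succ n => exact le_max_left _ _

lemma runMax_mono (T : A → A) (f : A → ℝ) (n : ℕ) : ∀ x, runMax T f n x ≤ runMax T f (n + 1) x := by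
  induction n with
  | zero => intro x; exact runMax_nonneg _ _ _ _
  | succ n ih =>
    intro x
    exact max_le_max le_rfl (by have := ih (T x); linarith)

lemma birkhoffSum_le_runMax (T : A → A) (f : A → ℝ) (n : ℕ) : ∀ x,
    birkhoffSum T f n x ≤ runMax T f n x := by
  induction n with
  | zero => intro x; simp [runMax]
  | succ n ih =>
    intro x
    rw [birkhoffSum_succ']
    exact le_trans (by have := ih (T x); linarith) (le_max_right _ _)

lemma measurable_runMax {T : A → A} {f : A → ℝ} (hT : Measurable T) (hf : Measurable f) (n : ℕ) :
    Measurable (runMax T f n) := by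
  induction n with
  | zero => exact measurable_const
  | succ n ih => exact measurable_const.max (hf.add (ih.comp hT))

lemma runMax_le {T : A → A} {f : A → ℝ} {K : ℝ} (hK : 0 ≤ K) (hf : ∀ x, |f x| ≤ K) (n : ℕ) :
    ∀ x, runMax T f n x ≤ n * K := by
  induction n with
  | zero => intro x; simp [runMax]
  | succ n ih =>
    intro x
    have h1 := ih (T x)
    have h2 := (abs_le.1 (hf x)).2
    push_cast
    refine max_le (by positivity) (by linarith)

lemma maximal_ergodic (ν : Measure A) [IsFiniteMeasure ν] {T : A → A} {f : A → ℝ} {K : ℝ}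
    (hT : MeasurePreserving T ν ν) (hf : Measurable f) (hK : 0 ≤ K) (hfK : ∀ x, |f x| ≤ K)
    (hpos : ∀ᵐ x ∂ν, ∃ n, 0 < birkhoffSum T f n x) : 0 ≤ ∫ x, f x ∂ν := by
  have hMm := fun n => measurable_runMax hT.measurable hf n
  have hMi : ∀ n, Integrable (runMax T f n) ν := fun n =>
    Integrable.of_bound (hMm n).aestronglyMeasurable (n * K) (Filter.Eventually.of_forall fun x => by
      rw [Real.norm_eq_abs, abs_of_nonneg (runMax_nonneg _ _ _ _)]
      exact runMax_le hK hfK n x)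
  have hfi : Integrable f ν := Integrable.of_bound hf.aestronglyMeasurable K
    (Filter.Eventually.of_forall hfK)
  let D : ℕ → Set A := fun n => {x | 0 < runMax T f n x}
  have hD : ∀ n, MeasurableSet (D n) := fun n => measurableSet_lt measurable_const (hMm n)
  have hmono : Monotone D := monotone_nat_of_le_succ fun n x hx =>
    lt_of_lt_of_le hx (runMax_mono T f n x)
  have step : ∀ n, 0 ≤ ∫ x in D n, f x ∂ν := by
    intro n
    cases n with
    | zero => simp [D, runMax]
    | succ n =>
      have hMT : Integrable (fun x => runMax T f (n + 1) (T x)) ν :=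
        hT.integrable_comp_of_integrable (hMi (n + 1))
      have e1 : ∫ x, runMax T f (n + 1) (T x) ∂ν = ∫ x, runMax T f (n + 1) x ∂ν := by
        have := integral_map (μ := ν) hT.aemeasurable (f := runMax T f (n + 1))
          (hMm _).aestronglyMeasurable
        rw [hT.map_eq] at this
        exact this.symm
      have e2 : ∫ x in D (n + 1), runMax T f (n + 1) x ∂ν = ∫ x, runMax T f (n + 1) x ∂ν := by
        refine setIntegral_eq_integral_of_forall_compl_eq_zero fun x hx => ?_
        exact le_antisymm (not_lt.1 hx) (runMax_nonneg _ _ _ _)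
      have e3 : ∫ x in D (n + 1), runMax T f (n + 1) (T x) ∂ν ≤ ∫ x, runMax T f (n + 1) (T x) ∂ν :=
        setIntegral_le_integral hMT (Filter.Eventually.of_forall fun x => runMax_nonneg _ _ _ _)
      have e4 : ∫ x in D (n + 1), (runMax T f (n + 1) x - runMax T f (n + 1) (T x)) ∂ν
          ≤ ∫ x in D (n + 1), f x ∂ν := by
        refine setIntegral_mono_on ((hMi _).sub hMT).integrableOn hfi.integrableOn (hD _) ?_
        intro x hx
        have hx' : 0 < max 0 (f x + runMax T f n (T x)) := hx
        have h1 : runMax T f (n + 1) x = f x + runMax T f n (T x) := by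
          rcases lt_max_iff.1 hx' with h | h
          · exact absurd h (lt_irrefl _)
          · exact max_eq_right h.le
        have h2 := runMax_mono T f n (T x)
        linarith
      rw [integral_sub (hMi _).integrableOn hMT.integrableOn] at e4
      linarith
  have hlim := tendsto_setIntegral_of_monotone (μ := ν) (f := f) hD hmono hfi.integrableOn
  have hU : ∫ x in ⋃ n, D n, f x ∂ν = ∫ x, f x ∂ν := by
    refine setIntegral_eq_integral_of_ae_compl_eq_zero ?_
    filter_upwards [hpos] with x hx hx'
    obtain ⟨n, hn⟩ := hx
    have hxn : x ∈ D n := lt_of_lt_of_le hn (birkhoffSum_le_runMax T f n x)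
    exact absurd (Set.mem_iUnion.2 ⟨n, hxn⟩) hx'
  rw [hU] at hlim
  exact ge_of_tendsto' hlim step

end Maximal

section Freq

/-- number of `k < n` such that the `k`-shift of `x` is in `B` -/
noncomputable def cnt {α : Type*} (B : Set (ℕ → α)) (n : ℕ) (x : ℕ → α) : ℕ :=
  ∑ k ∈ Finset.range n, B.indicator (fun _ => 1) (sh k x)

lemma cnt_le {α : Type*} (B : Set (ℕ → α)) (n : ℕ) (x : ℕ → α) : cnt B n x ≤ n := by
  calc cnt B n x ≤ ∑ k ∈ Finset.range n, 1 :=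
        Finset.sum_le_sum fun k _ => Set.indicator_le_self' (fun _ _ => Nat.zero_le _) _
    _ = n := by simp

lemma cnt_add {α : Type*} (B : Set (ℕ → α)) (m n : ℕ) (x : ℕ → α) :
    cnt B (m + n) x = cnt B m x + cnt B n (sh m x) := by
  unfold cnt
  rw [Finset.sum_range_add]
  simp only [sh_sh]

lemma cnt_mono {α : Type*} (B : Set (ℕ → α)) {m n : ℕ} (h : m ≤ n) (x : ℕ → α) :
    cnt B m x ≤ cnt B n x := by
  obtain ⟨k, rfl⟩ := Nat.exists_eq_add_of_le h
  rw [cnt_add]; exact Nat.le_add_right _ _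

lemma measurable_cnt {α : Type*} [MeasurableSpace α] {B : Set (ℕ → α)} (hB : MeasurableSet B)
    (n : ℕ) : Measurable (cnt B n) := by
  unfold cnt
  refine Finset.measurable_sum _ fun k _ => ?_
  exact (measurable_const.indicator hB).comp (measurable_sh k)

/-- Linear growth of the counts. -/
def goodSet {α : Type*} (B : Set (ℕ → α)) (c : ℝ) : Set (ℕ → α) :=
  {x | ∀ K : ℕ, ∃ N : ℕ, ∀ n, N ≤ n → (K : ℝ) + c * n ≤ cnt B n x}

lemma measurableSet_goodSet {α : Type*} [MeasurableSpace α] {B : Set (ℕ → α)}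
    (hB : MeasurableSet B) (c : ℝ) : MeasurableSet (goodSet B c) := by
  have : goodSet B c = ⋂ K : ℕ, ⋃ N : ℕ, ⋂ n : ℕ, ⋂ _ : N ≤ n,
      {x | (K : ℝ) + c * n ≤ cnt B n x} := by
    ext x; simp [goodSet]
  rw [this]
  refine MeasurableSet.iInter fun K => MeasurableSet.iUnion fun N => MeasurableSet.iInter fun n =>
    MeasurableSet.iInter fun _ => ?_
  exact measurableSet_le measurable_const (measurable_from_top.comp (measurable_cnt hB n))

lemma goodSet_inv {α : Type*} (B : Set (ℕ → α)) {c : ℝ} (hc : 0 ≤ c) (hc1 : c ≤ 1) (m : ℕ)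
    (x : ℕ → α) : sh m x ∈ goodSet B c ↔ x ∈ goodSet B c := by
  constructor
  · intro h K
    obtain ⟨N, hN⟩ := h (K + m)
    refine ⟨N + m, fun n hn => ?_⟩
    obtain ⟨j, rfl⟩ := Nat.exists_eq_add_of_le (le_trans (Nat.le_add_left m N) hn)
    have h1 := hN j (by omega)
    rw [cnt_add]
    have h2 : c * (m : ℝ) ≤ m := by
      have : (0 : ℝ) ≤ m := Nat.cast_nonneg m
      nlinarith
    have h3 : (0 : ℝ) ≤ cnt B m x := Nat.cast_nonneg _
    push_cast at h1 ⊢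
    linarith
  · intro h K
    obtain ⟨N, hN⟩ := h (K + m)
    refine ⟨N, fun n hn => ?_⟩
    have h1 := hN (m + n) (by omega)
    rw [cnt_add] at h1
    have h2 : (cnt B m x : ℝ) ≤ m := by exact_mod_cast cnt_le B m x
    have h3 : 0 ≤ c * (m : ℝ) := by positivity
    push_cast at h1
    linarith

lemma sh_one_iter {α : Type*} (k : ℕ) (x : ℕ → α) : (sh 1)^[k] x = sh k x := by
  induction k generalizing x with
  | zero => simp
  | succ k ih => rw [Function.iterate_succ_apply, ih, sh_sh, Nat.add_comm]

variable {S : Type*} [MeasurableSpace S] [MeasurableSingletonClass S]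

/-- stationary path measure -/
noncomputable def statM {κ : Kernel S S} {Pz : S → Measure (ℕ → S)} (hF : IsMarkovFamily κ Pz)
    (π : Measure S) : Measure (ℕ → S) := π.bind (pathK hF)

lemma lintegral_statM {κ : Kernel S S} {Pz : S → Measure (ℕ → S)} (hF : IsMarkovFamily κ Pz)
    (π : Measure S) (G : (ℕ → S) → ℝ≥0∞) (hG : Measurable G) :
    ∫⁻ ω, G ω ∂(statM hF π) = ∫⁻ z, ∫⁻ ω, G ω ∂(Pz z) ∂π :=
  Measure.lintegral_bind (pathK hF).measurable.aemeasurable hG.aemeasurable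

lemma statM_shift {κ : Kernel S S} {Pz : S → Measure (ℕ → S)} (hF : IsMarkovFamily κ Pz)
    (π : Measure S) (hπ : IsInvariantMeasure κ π) :
    MeasurePreserving (sh 1) (statM hF π) (statM hF π) := by
  refine ⟨measurable_sh 1, ?_⟩
  refine Measure.ext_of_lintegral _ fun G hG => ?_
  rw [lintegral_map hG (measurable_sh 1), lintegral_statM hF π (fun ω => G (sh 1 ω)) (hG.comp (measurable_sh 1)),
    lintegral_statM hF π _ hG]
  have h1 : ∀ z, ∫⁻ ω, G (sh 1 ω) ∂(Pz z) = ∫⁻ z', ∫⁻ ω, G ω ∂(Pz z') ∂(κ z) := by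
    intro z
    rw [family_first_step hF z (fun ω => G (sh 1 ω)) (hG.comp (measurable_sh 1))]
    simp
  simp_rw [h1]
  have hm : Measurable (fun z' => ∫⁻ ω, G ω ∂(Pz z')) := hG.lintegral_kernel (κ := pathK hF)
  rw [← Measure.lintegral_bind κ.measurable.aemeasurable hm.aemeasurable]
  exact congrArg (fun ν => ∫⁻ z', ∫⁻ ω, G ω ∂(Pz z') ∂ν) hπ

lemma statM_prob {κ : Kernel S S} {Pz : S → Measure (ℕ → S)} (hF : IsMarkovFamily κ Pz)
    (π : Measure S) [IsProbabilityMeasure π] : IsProbabilityMeasure (statM hF π) := by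
  have := hF.1
  refine ⟨?_⟩
  have := lintegral_statM hF π (fun _ => 1) measurable_const
  simpa using this

/-- zero-one law -/
lemma zero_one {κ : Kernel S S} {Pz : S → Measure (ℕ → S)} (hF : IsMarkovFamily κ Pz)
    {ψ : Measure S} (hH : HarrisProp κ Pz ψ) (hψ : ψ ≠ 0)
    (J : Set (ℕ → S)) (hJ : MeasurableSet J) (hinv : ∀ n ω, sh n ω ∈ J ↔ ω ∈ J) :
    (∀ z, ∀ᵐ ω ∂(Pz z), ω ∉ J) ∨ (∀ z, ∀ᵐ ω ∂(Pz z), ω ∈ J) := by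
  have hp := hF.1
  have hmeas : Measurable (fun z => (Pz z J).toReal) :=
    ((pathK hF).measurable_coe hJ).ennreal_toReal
  let U : Set S := {z | (Pz z J).toReal ≤ 1 / 2}
  have hU : MeasurableSet U := measurableSet_le hmeas measurable_const
  have io : ∀ V : Set S, MeasurableSet V → 0 < ψ V → ∀ z,
      ∀ᵐ ω ∂(Pz z), ∃ᶠ k in Filter.atTop, ω k ∈ V := by
    intro V hV hpos z
    have h1 := hH V hV hpos z
    have hms : MeasurableSet {ω : ℕ → S | ∀ N : ℕ, ∃ k : ℕ, N ≤ k ∧ ω k ∈ V} := by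
      have : {ω : ℕ → S | ∀ N : ℕ, ∃ k : ℕ, N ≤ k ∧ ω k ∈ V}
          = ⋂ N : ℕ, ⋃ k : ℕ, ⋃ _ : N ≤ k, (fun ω : ℕ → S => ω k) ⁻¹' V := by
        ext ω; simp
      rw [this]
      exact MeasurableSet.iInter fun N => MeasurableSet.iUnion fun k =>
        MeasurableSet.iUnion fun _ => (measurable_pi_apply k) hV
    have h2 := (mem_ae_iff_prob_eq_one hms).2 h1
    filter_upwards [h2] with ω hω
    rw [Filter.frequently_atTop]
    exact hω
  by_cases h0 : 0 < ψ U
  · left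
    intro z
    filter_upwards [levy_invariant hF J hJ hinv z, io U hU h0 z] with ω h1 h2 hω
    rw [Set.indicator_of_mem hω] at h1
    have : (1 : ℝ) ≤ 1 / 2 := le_of_tendsto_of_frequently h1 (h2.mono fun k hk => hk)
    norm_num at this
  · right
    have hc : 0 < ψ Uᶜ := by
      rw [pos_iff_ne_zero]
      intro h
      apply hψ
      rw [← Measure.measure_univ_eq_zero, ← Set.union_compl_self U]
      exact measure_union_null (by simpa using h0) h
    intro z
    filter_upwards [levy_invariant hF J hJ hinv z, io _ hU.compl hc z] with ω h1 h2
    by_contra hω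
    rw [Set.indicator_of_notMem hω] at h1
    have : (1 : ℝ) / 2 ≤ 0 := ge_of_tendsto_of_frequently h1 (h2.mono fun k hk => by
      have hk' : ¬ (Pz (ω k) J).toReal ≤ 1 / 2 := hk
      exact (not_le.1 hk').le)
    norm_num at this

lemma freq_lemma {κ : Kernel S S} {Pz : S → Measure (ℕ → S)} (hF : IsMarkovFamily κ Pz)
    {ψ : Measure S} (hH : HarrisProp κ Pz ψ) (hψ : ψ ≠ 0) (π : Measure S) [IsProbabilityMeasure π]
    (hπ : IsInvariantMeasure κ π) (B : Set (ℕ → S)) (hB : MeasurableSet B)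
    (hpos : 0 < statM hF π B) :
    ∃ c : ℝ, 0 < c ∧ ∀ z, ∀ᵐ ω ∂(Pz z), ω ∈ goodSet B c := by
  have := hF.1
  have := statM_prob hF π
  set p : ℝ := (statM hF π).real B with hp
  have hp0 : 0 < p := ENNReal.toReal_pos hpos.ne' (measure_ne_top _ _)
  have hp1 : p ≤ 1 := measureReal_le_one
  refine ⟨p / 4, by positivity, ?_⟩
  have hG := measurableSet_goodSet hB (p / 4)
  rcases zero_one hF hH hψ (goodSet B (p / 4))ᶜ hG.compl
    (fun n ω => not_congr (goodSet_inv B (by positivity) (by linarith) n ω)) with h | h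
  · intro z
    filter_upwards [h z] with ω hω
    simpa using hω
  · exfalso
    have hJ : ∀ᵐ ω ∂(statM hF π), ω ∈ (goodSet B (p / 4))ᶜ := by
      rw [ae_iff]
      have e : {ω | ¬ ω ∈ (goodSet B (p / 4))ᶜ} = goodSet B (p / 4) := by ext ω; simp
      rw [e]
      have h1 := lintegral_statM hF π ((goodSet B (p / 4)).indicator 1)
        (measurable_one.indicator hG)
      rw [lintegral_indicator_one hG] at h1
      rw [h1]
      have h2 : ∀ z, ∫⁻ ω, (goodSet B (p / 4)).indicator 1 ω ∂(Pz z) = 0 := by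
        intro z
        rw [lintegral_indicator_one hG]
        have := h z
        rw [ae_iff] at this
        simpa using this
      simp [h2]
    let f : (ℕ → S) → ℝ := fun ω => p / 2 - B.indicator (fun _ => 1) ω
    have hf : Measurable f := measurable_const.sub (measurable_const.indicator hB)
    have hsum : ∀ n ω, birkhoffSum (sh 1) f n ω = p / 2 * n - cnt B n ω := by
      intro n ω
      simp only [birkhoffSum, f, sh_one_iter, Finset.sum_sub_distrib, cnt]
      push_cast
      congr 1
      · simp [mul_comm]
      · refine Finset.sum_congr rfl fun k _ => ?_
        by_cases hk : sh k ω ∈ B <;> simp [hk]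
    have hmax := maximal_ergodic (statM hF π) (f := f) (K := 2) (statM_shift hF π hπ) hf (by norm_num)
      (by
        intro ω
        by_cases hk : ω ∈ B
        · simp only [f, Set.indicator_of_mem hk]; rw [abs_le]; constructor <;> linarith
        · simp only [f, Set.indicator_of_notMem hk]; rw [abs_le]; constructor <;> linarith)
      (by
        filter_upwards [hJ] with ω hω
        simp only [goodSet, Set.mem_compl_iff, Set.mem_ofPred_eq, not_forall, not_exists] at hω
        obtain ⟨K, hK⟩ := hω
        obtain ⟨N, hN⟩ := exists_nat_gt (K / (p / 4))
        obtain ⟨n, hn, hlt⟩ := hK N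
        refine ⟨n, ?_⟩
        rw [hsum]
        rw [div_lt_iff₀ (by positivity)] at hN
        have : (N : ℝ) ≤ n := by exact_mod_cast hn
        have h3 : (N : ℝ) * (p / 4) ≤ n * (p / 4) := by gcongr
        push Not at hlt
        nlinarith)
    have hintg : ∫ ω, f ω ∂(statM hF π) = p / 2 - p := by
      simp only [f]
      rw [integral_sub (integrable_const _) ((integrable_const _).indicator hB),
        integral_indicator hB]
      simp [hp]
    linarith

end Freq

open scoped NNReal

section Density
set_option linter.unusedSectionVars false

variable {X : Type*} [MeasurableSpace X] {Y : Type*} [Fintype Y] [DecidableEq Y]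
  [MeasurableSpace Y] [MeasurableSingletonClass Y]

/-- the `X`-part of a path -/
def pX {X Y : Type*} (ω : ℕ → X × Y) : ℕ → X := fun k => (ω k).1
/-- the `Y`-part of a path -/
def pY {X Y : Type*} (ω : ℕ → X × Y) : ℕ → Y := fun k => (ω k).2

lemma measurable_pX : Measurable (pX : (ℕ → X × Y) → ℕ → X) :=
  measurable_pi_lambda _ fun k => measurable_fst.comp (measurable_pi_apply k)
lemma measurable_pY : Measurable (pY : (ℕ → X × Y) → ℕ → Y) :=
  measurable_pi_lambda _ fun k => measurable_snd.comp (measurable_pi_apply k)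

lemma pX_scons {X Y : Type*} (z : X × Y) (ω : ℕ → X × Y) : pX (scons z ω) = scons z.1 (pX ω) := by
  funext k; cases k <;> rfl
lemma pY_scons {X Y : Type*} (z : X × Y) (ω : ℕ → X × Y) : pY (scons z ω) = scons z.2 (pY ω) := by
  funext k; cases k <;> rfl
lemma pX_sh {X Y : Type*} (u : ℕ) (ω : ℕ → X × Y) : pX (sh u ω) = sh u (pX ω) := rfl

/-- prepend preimage -/
def consPre {α : Type*} (i : α) (A : Set (ℕ → α)) : Set (ℕ → α) := {y | scons i y ∈ A}

lemma measurableSet_consPre {α : Type*} [MeasurableSpace α] (i : α) {A : Set (ℕ → α)}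
    (hA : MeasurableSet A) : MeasurableSet (consPre i A) := by
  have : Measurable (fun y : ℕ → α => scons i y) :=
    measurable_scons.comp (measurable_const.prodMk measurable_id)
  exact this hA

/-- backward variables -/
noncomputable def HH (ρ : X × Y → X × Y → ℝ≥0) (Pz : X × Y → Measure (ℕ → X × Y)) :
    ℕ → Set (ℕ → Y) → (ℕ → X) → Y → ℝ≥0
  | 0, A, x, i => (Pz (x 0, i) (pY ⁻¹' A)).toNNReal
  | m + 1, A, x, i => ∑ j, ρ (x 1, j) (x 0, i) * HH ρ Pz m (consPre i A) (sh 1 x) j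

/-- multi-step transition densities -/
noncomputable def pp (ρ : X × Y → X × Y → ℝ≥0) : ℕ → (ℕ → X) → Y → Y → ℝ≥0
  | 0, _, i, j => if i = j then 1 else 0
  | m + 1, x, i, j => ∑ k, ρ (x 1, k) (x 0, i) * pp ρ m (sh 1 x) k j

lemma pp_congr (ρ : X × Y → X × Y → ℝ≥0) (m : ℕ) : ∀ (x x' : ℕ → X) (i j : Y),
    (∀ k ≤ m, x k = x' k) → pp ρ m x i j = pp ρ m x' i j := by
  induction m with
  | zero => intro x x' i j _; rfl
  | succ m ih =>
    intro x x' i j h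
    simp only [pp]
    refine Finset.sum_congr rfl fun k _ => ?_
    rw [h 0 (by omega), h 1 (by omega), ih (sh 1 x) (sh 1 x') k j (fun k hk => h _ (by omega))]

lemma HH_congr (ρ : X × Y → X × Y → ℝ≥0) (Pz : X × Y → Measure (ℕ → X × Y)) (m : ℕ) :
    ∀ (A : Set (ℕ → Y)) (x x' : ℕ → X) (i : Y),
    (∀ k ≤ m, x k = x' k) → HH ρ Pz m A x i = HH ρ Pz m A x' i := by
  induction m with
  | zero => intro A x x' i h; simp only [HH, h 0 le_rfl]
  | succ m ih =>
    intro A x x' i h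
    simp only [HH]
    refine Finset.sum_congr rfl fun k _ => ?_
    rw [h 0 (by omega), h 1 (by omega), ih _ (sh 1 x) (sh 1 x') k (fun k hk => h _ (by omega))]

lemma measurable_pp {ρ : X × Y → X × Y → ℝ≥0} (hρ : Measurable (Function.uncurry ρ)) (m : ℕ) :
    ∀ (i j : Y), Measurable (fun x => pp ρ m x i j) := by
  induction m with
  | zero => intro i j; exact measurable_const
  | succ m ih =>
    intro i j
    refine Finset.measurable_sum _ fun k _ => ?_
    have h0 : Measurable (fun x : ℕ → X => (((x 1, k), (x 0, i)) : (X × Y) × (X × Y))) :=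
      ((measurable_pi_apply (X := fun _ : ℕ => X) 1).prodMk measurable_const).prodMk
        ((measurable_pi_apply (X := fun _ : ℕ => X) 0).prodMk measurable_const)
    have h1 : Measurable (fun x : ℕ → X => ρ (x 1, k) (x 0, i)) := hρ.comp h0
    exact h1.mul ((ih k j).comp (measurable_sh 1))

variable {κ : Kernel (X × Y) (X × Y)} {Pz : X × Y → Measure (ℕ → X × Y)}

lemma measurable_HH [MeasurableSingletonClass X] {ρ : X × Y → X × Y → ℝ≥0}
    (hρ : Measurable (Function.uncurry ρ))
    (hF : IsMarkovFamily κ Pz) (m : ℕ) :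
    ∀ (A : Set (ℕ → Y)) (_ : MeasurableSet A) (i : Y), Measurable (fun x => HH ρ Pz m A x i) := by
  induction m with
  | zero =>
    intro A hA i
    have h1 : Measurable (fun z => Pz z (pY ⁻¹' A)) :=
      (pathK hF).measurable_coe (measurable_pY hA)
    exact (h1.comp ((measurable_pi_apply (X := fun _ : ℕ => X) 0).prodMk
      (measurable_const (a := i)))).ennreal_toNNReal
  | succ m ih =>
    intro A hA i
    refine Finset.measurable_sum _ fun k _ => ?_
    have h0 : Measurable (fun x : ℕ → X => (((x 1, k), (x 0, i)) : (X × Y) × (X × Y))) :=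
      ((measurable_pi_apply (X := fun _ : ℕ => X) 1).prodMk measurable_const).prodMk
        ((measurable_pi_apply (X := fun _ : ℕ => X) 0).prodMk measurable_const)
    have h1 : Measurable (fun x : ℕ → X => ρ (x 1, k) (x 0, i)) := hρ.comp h0
    exact h1.mul ((ih _ (measurableSet_consPre i hA) k).comp (measurable_sh 1))

/-- extend a finite vector to a sequence -/
def vext (d : X) {m : ℕ} (w : Fin m → X) : ℕ → X := fun k => if h : k < m then w ⟨k, h⟩ else d

lemma vext_cons (d : X) {m : ℕ} (a : X) (w : Fin m → X) :
    vext d (Fin.cons a w : Fin (m + 1) → X) = scons a (vext d w) := by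
  funext k
  cases k with
  | zero => simp [vext]
  | succ k =>
    simp only [vext, scons_succ, Nat.add_lt_add_iff_right]
    split_ifs with h
    · exact Fin.cons_succ (α := fun _ => X) a w ⟨k, h⟩
    · rfl

lemma measurable_vext (d : X) {m : ℕ} : Measurable (vext d : (Fin m → X) → ℕ → X) := by
  refine measurable_pi_lambda _ fun k => ?_
  by_cases h : k < m
  · simp only [vext, h, dite_true]; exact measurable_pi_apply _
  · simp only [vext, h, dite_false]; exact measurable_const

lemma lintegral_pi_cons (μ : Measure X) [SigmaFinite μ] (m : ℕ) (f : (Fin (m + 1) → X) → ℝ≥0∞)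
    (hf : Measurable f) :
    ∫⁻ v, f v ∂(Measure.pi fun _ : Fin (m + 1) => μ)
      = ∫⁻ a, ∫⁻ w, f (Fin.cons a w) ∂(Measure.pi fun _ : Fin m => μ) ∂μ := by
  have h := (measurePreserving_piFinSuccAbove (fun _ : Fin (m + 1) => μ) 0).symm
  rw [← h.lintegral_comp hf, lintegral_prod
    (fun a => f ((MeasurableEquiv.piFinSuccAbove (fun _ => X) 0).symm a))
    (hf.comp h.measurable).aemeasurable]
  refine lintegral_congr fun a => lintegral_congr fun w => ?_
  congr 1
  simp [MeasurableEquiv.piFinSuccAbove_symm_apply]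
  rfl

lemma lintegral_density {ρ : X × Y → X × Y → ℝ≥0} (hρ : Measurable (Function.uncurry ρ))
    (μ : Measure X) [SigmaFinite μ]
    (hκ : ∀ z, κ z = (μ.prod Measure.count).withDensity (fun z' => (ρ z' z : ℝ≥0∞)))
    (z : X × Y) (G : X × Y → ℝ≥0∞) (hG : Measurable G) :
    ∫⁻ z', G z' ∂(κ z) = ∫⁻ a, ∑ j, (ρ (a, j) z : ℝ≥0∞) * G (a, j) ∂μ := by
  have h1 : Measurable (fun z' => (ρ z' z : ℝ≥0∞)) :=
    (hρ.comp (measurable_id.prodMk measurable_const)).coe_nnreal_ennreal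
  rw [hκ z, lintegral_withDensity_eq_lintegral_mul _ h1 hG,
    lintegral_prod _ (h1.mul hG).aemeasurable]
  refine lintegral_congr fun a => ?_
  rw [lintegral_fintype]
  simp

lemma path_formula [MeasurableSingletonClass X] {ρ : X × Y → X × Y → ℝ≥0}
    (hρ : Measurable (Function.uncurry ρ))
    (μ : Measure X) [SigmaFinite μ] (hF : IsMarkovFamily κ Pz)
    (hκ : ∀ z, κ z = (μ.prod Measure.count).withDensity (fun z' => (ρ z' z : ℝ≥0∞)))
    (d : X) (m : ℕ) : ∀ (g : (ℕ → X) → ℝ≥0∞) (_ : Measurable g)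
    (_ : ∀ x x' : ℕ → X, (∀ k ≤ m, x k = x' k) → g x = g x')
    (A : Set (ℕ → Y)) (_ : MeasurableSet A) (x0 : X) (i : Y),
    ∫⁻ ω, g (pX ω) * A.indicator 1 (pY ω) ∂(Pz (x0, i))
      = ∫⁻ w, g (scons x0 (vext d w)) * (HH ρ Pz m A (scons x0 (vext d w)) i : ℝ≥0∞)
          ∂(Measure.pi fun _ : Fin m => μ) := by
  have hprob := hF.1
  induction m with
  | zero =>
    intro g hg hgd A hA x0 i
    have h1 : ∫⁻ ω, g (pX ω) * A.indicator 1 (pY ω) ∂(Pz (x0, i))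
        = ∫⁻ ω, g (fun _ => x0) * (pY ⁻¹' A).indicator 1 ω ∂(Pz (x0, i)) := by
      refine lintegral_congr_ae ((family_start hF (x0, i)).mono fun ω hω => ?_)
      have : g (pX ω) = g (fun _ => x0) := hgd _ _ fun k hk => by
        obtain rfl : k = 0 := by omega
        simp [pX, hω]
      simp only [this]
      rfl
    rw [h1, lintegral_const_mul _ (measurable_one.indicator (measurable_pY hA)),
      lintegral_indicator_one (measurable_pY hA), lintegral_unique]
    have h2 : ∀ w : Fin 0 → X, g (scons x0 (vext d w)) = g (fun _ => x0) := fun w =>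
      hgd _ _ fun k hk => by
        obtain rfl : k = 0 := by omega
        rfl
    rw [h2]
    simp [HH, ENNReal.coe_toNNReal (measure_ne_top _ _)]
  | succ m ih =>
    intro g hg hgd A hA x0 i
    have hsc : Measurable (fun x : ℕ → X => scons x0 x) :=
      measurable_scons.comp (measurable_const.prodMk measurable_id)
    have hm1 : Measurable (fun ω : ℕ → X × Y => g (pX ω) * A.indicator 1 (pY ω)) :=
      (hg.comp measurable_pX).mul ((measurable_one.indicator hA).comp measurable_pY)
    rw [family_first_step hF (x0, i) _ hm1]
    have e1 : ∀ z' : X × Y, ∫⁻ ω', g (pX (scons (x0, i) ω')) * A.indicator 1 (pY (scons (x0, i) ω'))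
        ∂(Pz z') = ∫⁻ w, g (scons x0 (scons z'.1 (vext d w))) *
          (HH ρ Pz m (consPre i A) (scons z'.1 (vext d w)) z'.2 : ℝ≥0∞)
          ∂(Measure.pi fun _ : Fin m => μ) := by
      intro z'
      rw [← ih (fun x => g (scons x0 x)) (hg.comp hsc) ?_ (consPre i A)
        (measurableSet_consPre i hA) z'.1 z'.2]
      · simp_rw [pX_scons, pY_scons]
        rfl
      · intro x x' h
        refine hgd _ _ fun k hk => ?_
        cases k with
        | zero => rfl
        | succ k => exact h k (by omega)
    have hmeas : ∀ j, Measurable (fun p : X × (Fin m → X) =>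
        g (scons x0 (scons p.1 (vext d p.2))) *
          (HH ρ Pz m (consPre i A) (scons p.1 (vext d p.2)) j : ℝ≥0∞)) := by
      intro j
      have h0 : Measurable (fun p : X × (Fin m → X) => scons p.1 (vext d p.2)) :=
        measurable_scons.comp (measurable_fst.prodMk ((measurable_vext d).comp measurable_snd))
      exact (hg.comp (hsc.comp h0)).mul
        ((measurable_HH hρ hF m _ (measurableSet_consPre i hA) j).comp h0).coe_nnreal_ennreal
    have hm2 : Measurable (fun z' : X × Y => ∫⁻ ω', g (pX (scons (x0, i) ω')) *
        A.indicator 1 (pY (scons (x0, i) ω')) ∂(Pz z')) := by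
      have : Measurable (fun ω' : ℕ → X × Y => g (pX (scons (x0, i) ω')) *
        A.indicator 1 (pY (scons (x0, i) ω'))) :=
        hm1.comp (measurable_scons.comp (measurable_const.prodMk measurable_id))
      exact this.lintegral_kernel (κ := pathK hF)
    rw [lintegral_density hρ μ hκ _ _ hm2, lintegral_pi_cons]
    · refine lintegral_congr fun a => ?_
      simp_rw [e1, vext_cons]
      simp only [HH, sh_one_scons, scons_zero]
      have : ∀ w : Fin m → X, scons x0 (scons a (vext d w)) 1 = a := fun w => rfl
      simp_rw [this]
      push_cast
      simp_rw [Finset.mul_sum]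
      have hma : ∀ j, Measurable (fun w : Fin m → X =>
          g (scons x0 (scons a (vext d w))) *
          (HH ρ Pz m (consPre i A) (scons a (vext d w)) j : ℝ≥0∞)) := fun j =>
        (hmeas j).comp (measurable_const.prodMk measurable_id)
      have e3 : ∀ (w : Fin m → X) (j : Y), g (scons x0 (scons a (vext d w))) *
          ((ρ (a, j) (x0, i) : ℝ≥0∞) * (HH ρ Pz m (consPre i A) (scons a (vext d w)) j : ℝ≥0∞))
          = (ρ (a, j) (x0, i) : ℝ≥0∞) * (g (scons x0 (scons a (vext d w))) *
          (HH ρ Pz m (consPre i A) (scons a (vext d w)) j : ℝ≥0∞)) := fun w j => by ring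
      simp_rw [e3]
      rw [lintegral_finsetSum _ fun j _ => (hma j).const_mul _]
      refine Finset.sum_congr rfl fun j _ => ?_
      rw [lintegral_const_mul _ (hma j)]
    · have h0 : Measurable (fun w : Fin (m + 1) → X => scons x0 (vext d w)) :=
        hsc.comp (measurable_vext d)
      exact (hg.comp h0).mul ((measurable_HH hρ hF (m + 1) A hA i).comp h0).coe_nnreal_ennreal

end Density

section Blocks
set_option linter.unusedSectionVars false

variable {X : Type*} [MeasurableSpace X] {Y : Type*} [Fintype Y] [DecidableEq Y]
  [MeasurableSpace Y] [MeasurableSingletonClass Y]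

lemma sum_cons_eq {M : Type*} [AddCommMonoid M] (m : ℕ) (f : (Fin (m + 1) → Y) → M) :
    ∑ y, f y = ∑ a, ∑ w : Fin m → Y, f (Fin.cons a w) := by
  rw [← (Fin.consEquiv (fun _ : Fin (m + 1) => Y)).sum_comp, Fintype.sum_prod_type]
  rfl

lemma pijD_eq (q : X × Y → X × Y → ℝ≥0∞) (ρ : X × Y → X × Y → ℝ≥0) (j : Y) (m : ℕ) :
    ∀ (x : ℕ → X) (_ : ∀ k < m, ∀ y y', q (x (k + 1), y') (x k, y) = ρ (x (k + 1), y') (x k, y))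
      (i : Y), pijD q (fun k : Fin (m + 1) => x k) i j = (pp ρ m x i j : ℝ≥0∞) := by
  induction m with
  | zero =>
    intro x _ i
    unfold pijD
    rw [sum_cons_eq]
    simp only [pp]
    rw [Finset.sum_eq_single i]
    · by_cases hij : i = j <;> simp [hij]
    · intro b _ hb
      simp [hb]
    · simp
  | succ m ih =>
    intro x hq i
    have e : ∀ k, (pp ρ m (sh 1 x) k j : ℝ≥0∞) = pijD q (fun l : Fin (m + 1) => sh 1 x l) k j :=
      fun k => (ih (sh 1 x) (fun l hl y y' => by
        have := hq (1 + l) (by omega) y y'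
        simp only [sh_apply]
        rw [show 1 + (l + 1) = 1 + l + 1 by omega]
        exact this) k).symm
    simp only [pp]
    push_cast
    simp_rw [e]
    unfold pijD
    rw [sum_cons_eq, Finset.sum_eq_single i]
    rotate_left
    · intro b _ hb
      simp [hb]
    · simp
    simp_rw [Finset.mul_sum]
    rw [Finset.sum_comm]
    refine Finset.sum_congr rfl fun w _ => ?_
    rw [Finset.sum_eq_single (w 0)]
    rotate_left
    · intro b _ hb
      simp [Ne.symm hb]
    · simp
    have h0 := hq 0 (by omega) i (w 0)
    by_cases hw : w (Fin.last m) = j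
    · have : (Fin.cons i w : Fin (m + 2) → Y) (Fin.last (m + 1)) = j := by
        rw [← Fin.succ_last]; simpa using hw
      simp only [this, hw, Fin.cons_zero, and_self, if_true]
      rw [Fin.prod_univ_succ]
      refine congrArg₂ (· * ·) ?_ ?_
      · simpa using h0
      · refine Finset.prod_congr rfl fun k _ => ?_
        have e1 : 1 + (k : ℕ) = (k : ℕ) + 1 := by omega
        have e2 : 1 + ((k : ℕ) + 1) = (k : ℕ) + 1 + 1 := by omega
        simp only [sh_apply, Fin.val_succ, Fin.val_castSucc, e1, e2, Fin.cons_succ]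
        simp
    · have : (Fin.cons i w : Fin (m + 2) → Y) (Fin.last (m + 1)) ≠ j := by
        rw [← Fin.succ_last]; simpa using hw
      simp [hw]

lemma ae_pi_cons (μ : Measure X) [SigmaFinite μ] (m : ℕ) (S : Set (Fin (m + 1) → X))
    (hS : MeasurableSet S)
    (h : ∀ᵐ a ∂μ, ∀ᵐ w ∂(Measure.pi fun _ : Fin m => μ), (Fin.cons a w : Fin (m + 1) → X) ∈ S) :
    ∀ᵐ v ∂(Measure.pi fun _ : Fin (m + 1) => μ), v ∈ S := by
  have h1 := lintegral_pi_cons μ m (Sᶜ.indicator 1) (measurable_one.indicator hS.compl)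
  rw [lintegral_indicator_one hS.compl] at h1
  have h2 : ∫⁻ a, ∫⁻ w, Sᶜ.indicator (1 : (Fin (m + 1) → X) → ℝ≥0∞) (Fin.cons a w)
      ∂(Measure.pi fun _ : Fin m => μ) ∂μ = 0 := by
    rw [← lintegral_zero (μ := μ)]
    refine lintegral_congr_ae (h.mono fun a ha => ?_)
    simp only
    rw [← lintegral_zero (μ := Measure.pi fun _ : Fin m => μ)]
    refine lintegral_congr_ae (ha.mono fun w hw => ?_)
    simp [hw]
  rw [h2] at h1
  exact h1

lemma ae_path (μ : Measure X) [SigmaFinite μ] (G : Set ((X × Y) × (X × Y))) (hG : MeasurableSet G)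
    (h : ∀ z, ∀ᵐ a ∂μ, ∀ y', ((a, y'), z) ∈ G) (d : X) (m : ℕ) : ∀ x0 : X,
    ∀ᵐ w ∂(Measure.pi fun _ : Fin m => μ), ∀ k < m, ∀ y y',
      ((scons x0 (vext d w) (k + 1), y'), (scons x0 (vext d w) k, y)) ∈ G := by
  induction m with
  | zero => intro x0; exact Filter.Eventually.of_forall fun w k hk => absurd hk (by omega)
  | succ m ih =>
    intro x0
    refine ae_pi_cons μ m {w | ∀ k < m + 1, ∀ y y',
      ((scons x0 (vext d w) (k + 1), y'), (scons x0 (vext d w) k, y)) ∈ G} ?_ ?_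
    · have h0 : Measurable (fun w : Fin (m + 1) → X => scons x0 (vext d w)) :=
        measurable_scons.comp (measurable_const.prodMk (measurable_vext d))
      have : {w : Fin (m + 1) → X | ∀ k < m + 1, ∀ y y',
        ((scons x0 (vext d w) (k + 1), y'), (scons x0 (vext d w) k, y)) ∈ G}
        = ⋂ k, ⋂ _ : k < m + 1, ⋂ y : Y, ⋂ y' : Y, (fun w : Fin (m + 1) → X =>
          ((scons x0 (vext d w) (k + 1), y'), (scons x0 (vext d w) k, y))) ⁻¹' G := by
        ext w; simp
      rw [this]
      refine MeasurableSet.iInter fun k => MeasurableSet.iInter fun _ => MeasurableSet.iInter fun y =>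
        MeasurableSet.iInter fun y' => ?_
      have h1 : Measurable (fun w : Fin (m + 1) → X =>
          (((scons x0 (vext d w) (k + 1), y'), (scons x0 (vext d w) k, y)) : (X × Y) × (X × Y))) :=
        (((measurable_pi_apply (k + 1)).comp h0).prodMk measurable_const).prodMk
          (((measurable_pi_apply k).comp h0).prodMk measurable_const)
      exact h1 hG
    · have hall : ∀ᵐ a ∂μ, ∀ y y', ((a, y'), (x0, y)) ∈ G := by
        rw [ae_all_iff]; intro y; exact h (x0, y)
      filter_upwards [hall] with a ha
      filter_upwards [ih a] with w hw
      show ∀ k < m + 1, ∀ y y', ((scons x0 (vext d (Fin.cons a w : Fin (m + 1) → X)) (k + 1), y'),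
        (scons x0 (vext d (Fin.cons a w : Fin (m + 1) → X)) k, y)) ∈ G
      rw [vext_cons]
      intro k hk y y'
      cases k with
      | zero => exact ha y y'
      | succ k => exact hw k (by omega) y y'

variable {κ : Kernel (X × Y) (X × Y)} {Pz : X × Y → Measure (ℕ → X × Y)}

/-- good blocks -/
def EM (ρ : X × Y → X × Y → ℝ≥0) (R : ℕ) (Yp : Set (Y × Y)) (M : ℕ) : Set (ℕ → X) :=
  {x | ∀ i j, ((i, j) ∈ Yp → (1 : ℝ≥0) ≤ (M : ℝ≥0) * pp ρ R x i j ∧ pp ρ R x i j ≤ (M : ℝ≥0)) ∧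
    ((i, j) ∉ Yp → pp ρ R x i j = 0)}

lemma measurableSet_EM {ρ : X × Y → X × Y → ℝ≥0} (hρ : Measurable (Function.uncurry ρ))
    (R : ℕ) (Yp : Set (Y × Y)) (M : ℕ) : MeasurableSet (EM ρ R Yp M) := by
  have : EM ρ R Yp M = ⋂ i, ⋂ j, {x | ((i, j) ∈ Yp → (1 : ℝ≥0) ≤ (M : ℝ≥0) * pp ρ R x i j ∧ pp ρ R x i j ≤ (M : ℝ≥0)) ∧
    ((i, j) ∉ Yp → pp ρ R x i j = 0)} := by
    ext x; simp [EM]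
  rw [this]
  refine MeasurableSet.iInter fun i => MeasurableSet.iInter fun j => ?_
  have hm := measurable_pp hρ R i j
  by_cases h : (i, j) ∈ Yp
  · simp only [h, true_imp_iff, not_true, false_imp_iff, and_true]
    have a1 : MeasurableSet {x | (1 : ℝ≥0) ≤ (M : ℝ≥0) * pp ρ R x i j} :=
      measurableSet_le measurable_const (hm.const_mul _)
    have a2 : MeasurableSet {x | pp ρ R x i j ≤ (M : ℝ≥0)} :=
      measurableSet_le hm measurable_const
    exact a1.inter a2
  · simp only [h, true_imp_iff, not_false_iff, false_imp_iff, true_and]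
    exact hm (measurableSet_singleton 0)

lemma EM_mono (ρ : X × Y → X × Y → ℝ≥0) (R : ℕ) (Yp : Set (Y × Y)) : Monotone (EM ρ R Yp) := by
  intro M N h x hx i j
  have hMN : (M : ℝ≥0) ≤ N := by exact_mod_cast h
  exact ⟨fun hij => ⟨((hx i j).1 hij).1.trans (mul_le_mul_left hMN _),
    ((hx i j).1 hij).2.trans hMN⟩, (hx i j).2⟩

lemma mem_iUnion_EM (ρ : X × Y → X × Y → ℝ≥0) (R : ℕ) (Yp : Set (Y × Y)) (x : ℕ → X)
    (h : ∀ i j, (i, j) ∈ Yp ↔ 0 < pp ρ R x i j) : x ∈ ⋃ M, EM ρ R Yp M := by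
  have key : ∀ p : Y × Y, ∃ M : ℕ, ∀ N ≥ M, (0 < pp ρ R x p.1 p.2 →
      (1 : ℝ≥0) ≤ N * pp ρ R x p.1 p.2 ∧ pp ρ R x p.1 p.2 ≤ N) := by
    intro p
    obtain ⟨M1, h1⟩ := exists_nat_ge (pp ρ R x p.1 p.2)
    obtain ⟨M2, h2⟩ := exists_nat_ge (pp ρ R x p.1 p.2)⁻¹
    refine ⟨max M1 M2, fun N hN hp => ⟨?_, ?_⟩⟩
    · have : (pp ρ R x p.1 p.2)⁻¹ ≤ N := h2.trans (by exact_mod_cast (le_max_right _ _).trans hN)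
      calc (1 : ℝ≥0) = (pp ρ R x p.1 p.2)⁻¹ * pp ρ R x p.1 p.2 := (inv_mul_cancel₀ hp.ne').symm
        _ ≤ _ := mul_le_mul_left this _
    · exact h1.trans (by exact_mod_cast (le_max_left _ _).trans hN)
  choose M hM using key
  refine Set.mem_iUnion.2 ⟨∑ p, M p, fun i j => ⟨fun hij => ?_, fun hij => ?_⟩⟩
  · exact hM (i, j) _ (Finset.single_le_sum (f := M) (fun _ _ => Nat.zero_le _) (Finset.mem_univ _))
      ((h i j).1 hij)
  · by_contra hne
    exact hij ((h i j).2 (pos_iff_ne_zero.2 hne))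

lemma EM_congr (ρ : X × Y → X × Y → ℝ≥0) (R : ℕ) (Yp : Set (Y × Y)) (M : ℕ) (x x' : ℕ → X)
    (h : ∀ k ≤ R, x k = x' k) : x ∈ EM ρ R Yp M ↔ x' ∈ EM ρ R Yp M := by
  have := fun i j => pp_congr ρ R x x' i j h
  show (∀ i j, _) ↔ (∀ i j, _)
  simp_rw [this]

lemma HH_univ (ρ : X × Y → X × Y → ℝ≥0) (hF : IsMarkovFamily κ Pz) (m : ℕ) :
    ∀ (x : ℕ → X) (i : Y), HH ρ Pz m Set.univ x i = ∑ j, pp ρ m x i j := by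
  have := hF.1
  induction m with
  | zero => intro x i; simp [HH, pp]
  | succ m ih =>
    intro x i
    have e : consPre i (Set.univ : Set (ℕ → Y)) = Set.univ := by ext; simp [consPre]
    simp only [HH, pp, e, ih]
    rw [Finset.sum_comm]
    simp_rw [Finset.mul_sum]

lemma pos_EM [MeasurableSingletonClass X] {ρ : X × Y → X × Y → ℝ≥0}
    (hρ : Measurable (Function.uncurry ρ))
    (q : X × Y → X × Y → ℝ≥0∞) (hq : Measurable (Function.uncurry q))
    (μ : Measure X) [SigmaFinite μ] (hF : IsMarkovFamily κ Pz)
    (hκ : ∀ z, κ z = (μ.prod Measure.count).withDensity (fun z' => (ρ z' z : ℝ≥0∞)))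
    (hqρ : ∀ z, ∀ᵐ a ∂μ, ∀ y', q (a, y') z = ρ (a, y') z)
    {R : ℕ} (E : Set (Fin (R + 1) → X)) (Yp : Set (Y × Y)) (hA1 : Assumption1 q E Yp)
    (x1 : X) (i : Y) (hi : i ∈ Prod.fst '' Yp)
    (hpos : 0 < (Measure.pi fun _ : Fin R => μ) (secSet E x1)) :
    0 < Pz (x1, i) (pX ⁻¹' (⋃ M, EM ρ R Yp M)) := by
  have := hF.1
  set U : Set (ℕ → X) := ⋃ M, EM ρ R Yp M with hU
  have hUm : MeasurableSet U := MeasurableSet.iUnion fun M => measurableSet_EM hρ R Yp M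
  have hf := path_formula hρ μ hF hκ x1 R (U.indicator 1) (measurable_one.indicator hUm)
    (fun x x' h => by
      have : x ∈ U ↔ x' ∈ U := by
        simp only [hU, Set.mem_iUnion]
        exact exists_congr fun M => EM_congr ρ R Yp M x x' h
      by_cases hx : x ∈ U
      · simp [hx, this.1 hx]
      · rw [Set.indicator_of_notMem hx, Set.indicator_of_notMem fun h => hx (this.2 h)]) Set.univ MeasurableSet.univ x1 i
  have e1 : ∫⁻ ω, U.indicator (1 : (ℕ → X) → ℝ≥0∞) (pX ω) * Set.univ.indicator 1 (pY ω) ∂(Pz (x1, i))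
      = Pz (x1, i) (pX ⁻¹' U) := by
    rw [← lintegral_indicator_one (measurable_pX hUm)]
    refine lintegral_congr fun ω => ?_
    simp only [Set.indicator_univ, Pi.one_apply, mul_one]
    rfl
  rw [← e1, hf, pos_iff_ne_zero]
  intro h0
  have hsc : Measurable (fun w : Fin R → X => scons x1 (vext x1 w)) :=
    measurable_scons.comp (measurable_const.prodMk (measurable_vext x1))
  have hmm : Measurable (fun w : Fin R → X => U.indicator (1 : (ℕ → X) → ℝ≥0∞)
      (scons x1 (vext x1 w)) * (HH ρ Pz R Set.univ (scons x1 (vext x1 w)) i : ℝ≥0∞)) :=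
    ((measurable_one.indicator hUm).comp hsc).mul
    ((measurable_HH hρ hF R _ MeasurableSet.univ i).comp hsc).coe_nnreal_ennreal
  rw [lintegral_eq_zero_iff hmm] at h0
  obtain ⟨⟨i', j⟩, hij, rfl⟩ := hi
  have hpath := ae_path μ {p : (X × Y) × (X × Y) | q p.1 p.2 = ρ p.1 p.2}
    (measurableSet_eq_fun hq (measurable_coe_nnreal_ennreal.comp hρ)) hqρ x1 R x1
  have : ∀ᵐ w ∂(Measure.pi fun _ : Fin R => μ), w ∉ secSet E x1 := by
    filter_upwards [h0, hpath] with w hw hp hwE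
    have hE : (Fin.cons x1 w : Fin (R + 1) → X) ∈ E := hwE
    have hYp := hA1.2.2.1 _ hE
    set x := scons x1 (vext x1 w) with hx
    have hxe : (Fin.cons x1 w : Fin (R + 1) → X) = fun k : Fin (R + 1) => x k := by
      funext k
      rw [hx, ← vext_cons]
      exact (dif_pos k.2).symm
    have hpe := fun i j => pijD_eq q ρ j R x hp i
    have hiff : ∀ i j, (i, j) ∈ Yp ↔ 0 < pp ρ R x i j := by
      intro i j
      rw [← hYp, hxe]
      show 0 < pijD q _ i j ↔ _
      rw [hpe, ENNReal.coe_pos]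
    have hxU := mem_iUnion_EM ρ R Yp x hiff
    have hw' : U.indicator (1 : (ℕ → X) → ℝ≥0∞) x * (HH ρ Pz R Set.univ x i' : ℝ≥0∞) = 0 := hw
    rw [Set.indicator_of_mem hxU, Pi.one_apply, one_mul, HH_univ ρ hF] at hw'
    have h3 : ∑ j, pp ρ R x i' j = 0 := by exact_mod_cast hw'
    have h4 := (Finset.sum_eq_zero_iff.1 h3) j (Finset.mem_univ _)
    exact ((hiff i' j).1 hij).ne' h4
  exact hpos.ne' (by
    have h5 := this
    rw [ae_iff] at h5
    simpa using h5)

end Blocks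

section Freq
set_option linter.unusedSectionVars false

variable {X : Type*} [MeasurableSpace X] {Y : Type*} [Fintype Y] [DecidableEq Y]
  [MeasurableSpace Y] [MeasurableSingletonClass Y]
variable {κ : Kernel (X × Y) (X × Y)} {Pz : X × Y → Measure (ℕ → X × Y)}

lemma exists_density [MeasurableSingletonClass X] (q : X × Y → X × Y → ℝ≥0∞)
    (hq : Measurable (Function.uncurry q))
    (μ : Measure X) [SigmaFinite μ] (hF : IsMarkovFamily κ Pz)
    (hκ : ∀ z, (κ z : Measure (X × Y)) = (μ.prod Measure.count).withDensity (fun z' => q z' z)) :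
    ∃ ρ : X × Y → X × Y → ℝ≥0, Measurable (Function.uncurry ρ) ∧
      (∀ z, κ z = (μ.prod Measure.count).withDensity (fun z' => (ρ z' z : ℝ≥0∞))) ∧
      ∀ z, ∀ᵐ a ∂μ, ∀ y', q (a, y') z = ρ (a, y') z := by
  have hK : IsMarkovKernel κ := family_kernel_markov hF
  have hae : ∀ z, ∀ᵐ z' ∂(μ.prod (Measure.count : Measure Y)), q z' z = ((q z' z).toNNReal : ℝ≥0∞) := by
    intro z
    have hm : Measurable (fun z' => q z' z) := hq.comp (measurable_id.prodMk measurable_const)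
    have h1 : ∫⁻ z', q z' z ∂(μ.prod (Measure.count : Measure Y)) ≠ ∞ := by
      have : κ z Set.univ = 1 := measure_univ
      rw [hκ z, withDensity_apply _ MeasurableSet.univ, Measure.restrict_univ] at this
      rw [this]; exact ENNReal.one_ne_top
    exact (ae_lt_top hm h1).mono fun z' h => (ENNReal.coe_toNNReal h.ne).symm
  refine ⟨fun z' z => (q z' z).toNNReal, hq.ennreal_toNNReal, fun z => ?_, fun z => ?_⟩
  · rw [hκ z]
    exact withDensity_congr_ae (hae z)
  · have := Measure.ae_ae_of_ae_prod (hae z)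
    filter_upwards [this] with a ha
    exact Measure.ae_count_iff.1 ha

lemma statM_pos {S : Type*} [MeasurableSpace S] [MeasurableSingletonClass S] {κ : Kernel S S}
    {Pz : S → Measure (ℕ → S)} (hF : IsMarkovFamily κ Pz)
    {ψ : Measure S} (hH : HarrisProp κ Pz ψ) (π : Measure S) [IsProbabilityMeasure π]
    (hπ : IsInvariantMeasure κ π) (D : Set S) (hD : MeasurableSet D) (hpos : 0 < ψ D) :
    0 < π D := by
  have := hF.1
  rw [pos_iff_ne_zero]
  intro h0
  have hst : ∀ (B : Set (ℕ → S)), MeasurableSet B → statM hF π B = ∫⁻ z, Pz z B ∂π := by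
    intro B hB
    rw [← lintegral_indicator_one hB, lintegral_statM hF π _ (measurable_one.indicator hB)]
    simp_rw [lintegral_indicator_one hB]
  have hD0 : MeasurableSet {ω : ℕ → S | ω 0 ∈ D} := (measurable_pi_apply 0) hD
  have h1 : statM hF π {ω | ω 0 ∈ D} = 0 := by
    rw [hst _ hD0]
    have : ∀ z, Pz z {ω | ω 0 ∈ D} = D.indicator 1 z := by
      intro z
      by_cases hz : z ∈ D
      · rw [Set.indicator_of_mem hz, Pi.one_apply, ← (measure_univ (μ := Pz z))]
        refine measure_congr ((family_start hF z).mono fun ω hω => ?_)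
        refine propext ⟨fun _ => trivial, fun _ => ?_⟩
        show ω 0 ∈ D
        rw [hω]; exact hz
      · rw [Set.indicator_of_notMem hz]
        have h2 : ∀ᵐ ω ∂(Pz z), ω ∉ {ω : ℕ → S | ω 0 ∈ D} := (family_start hF z).mono fun ω hω h => by
          have h' : ω 0 ∈ D := h
          rw [hω] at h'; exact hz h'
        have h3 := ae_iff.1 h2
        simpa using h3
    simp_rw [this]
    rw [lintegral_indicator_one hD, h0]
  have h2 : ∀ k, statM hF π {ω | ω k ∈ D} = 0 := by
    intro k
    rw [← h1, ← ((statM_shift hF π hπ).iterate k).measure_preimage hD0.nullMeasurableSet]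
    congr 1
    ext ω
    show ω k ∈ D ↔ ((sh 1)^[k] ω) 0 ∈ D
    rw [sh_one_iter]; rfl
  have hIm : MeasurableSet {ω : ℕ → S | ∀ N : ℕ, ∃ k : ℕ, N ≤ k ∧ ω k ∈ D} := by
    have : {ω : ℕ → S | ∀ N : ℕ, ∃ k : ℕ, N ≤ k ∧ ω k ∈ D}
        = ⋂ N : ℕ, ⋃ k : ℕ, ⋃ _ : N ≤ k, {ω | ω k ∈ D} := by
      ext ω; simp
    rw [this]
    exact MeasurableSet.iInter fun N => MeasurableSet.iUnion fun k => MeasurableSet.iUnion fun _ =>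
      (measurable_pi_apply k) hD
  have h3 : statM hF π {ω : ℕ → S | ∀ N : ℕ, ∃ k : ℕ, N ≤ k ∧ ω k ∈ D} = 1 := by
    rw [hst _ hIm]
    simp_rw [hH D hD hpos]
    simp
  have h4 : statM hF π {ω : ℕ → S | ∀ N : ℕ, ∃ k : ℕ, N ≤ k ∧ ω k ∈ D} = 0 := by
    refine measure_mono_null (t := ⋃ k, {ω | ω k ∈ D}) ?_ (measure_iUnion_null h2)
    intro ω hω
    obtain ⟨k, _, hk⟩ := hω 0
    exact Set.mem_iUnion.2 ⟨k, hk⟩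
  rw [h3] at h4
  exact one_ne_zero h4

lemma block_freq [MeasurableSingletonClass X] {ρ : X × Y → X × Y → ℝ≥0}
    (hρ : Measurable (Function.uncurry ρ))
    (q : X × Y → X × Y → ℝ≥0∞) (hq : Measurable (Function.uncurry q))
    (μ : Measure X) [SigmaFinite μ] (hF : IsMarkovFamily κ Pz)
    (hκ : ∀ z, κ z = (μ.prod Measure.count).withDensity (fun z' => (ρ z' z : ℝ≥0∞)))
    (hqρ : ∀ z, ∀ᵐ a ∂μ, ∀ y', q (a, y') z = ρ (a, y') z)
    {R : ℕ} (E : Set (Fin (R + 1) → X)) (Yp : Set (Y × Y)) (hA1 : Assumption1 q E Yp)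
    (ψ : Measure (X × Y)) (hA2 : Assumption2 κ ψ μ E Yp) (hH : HarrisProp κ Pz ψ)
    (hPos : IsPositive κ) :
    ∃ M : ℕ, 2 ≤ M ∧ ∃ c : ℝ, 0 < c ∧ ∀ z, ∀ᵐ ω ∂(Pz z), pX ω ∈ goodSet (EM ρ R Yp M) c := by
  have := hF.1
  obtain ⟨π, hπp, hπ⟩ := hPos
  set U : Set (ℕ → X) := ⋃ M, EM ρ R Yp M with hU
  have hUm : MeasurableSet U := MeasurableSet.iUnion fun M => measurableSet_EM hρ R Yp M
  have hPm : Measurable (fun z => Pz z (pX ⁻¹' U)) := (pathK hF).measurable_coe (measurable_pX hUm)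
  set D : Set (X × Y) := {z | 0 < Pz z (pX ⁻¹' U)} with hDdef
  have hD : MeasurableSet D := measurableSet_lt measurable_const hPm
  have hsub : proj1 E ×ˢ (Prod.fst '' Yp) ⊆ D := by
    rintro ⟨x1, i⟩ ⟨h1, h2⟩
    exact pos_EM hρ q hq μ hF hκ hqρ E Yp hA1 x1 i h2 (hA2.2.2 x1 h1)
  have hψD : 0 < ψ D := hA2.2.1.trans_le (measure_mono hsub)
  have hψ : ψ ≠ 0 := by
    rintro rfl
    simp at hψD
  have hπD := statM_pos hF hH π hπ D hD hψD
  have hst : statM hF π (pX ⁻¹' U) = ∫⁻ z, Pz z (pX ⁻¹' U) ∂π := by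
    rw [← lintegral_indicator_one (measurable_pX hUm),
      lintegral_statM hF π _ (measurable_one.indicator (measurable_pX hUm))]
    simp_rw [lintegral_indicator_one (measurable_pX hUm)]
  have h1 : statM hF π (pX ⁻¹' U) ≠ 0 := by
    rw [hst]
    intro h0
    rw [lintegral_eq_zero_iff hPm] at h0
    have h2 : π D = 0 := by
      refine measure_mono_null ?_ (ae_iff.1 h0)
      intro z hz
      have : 0 < Pz z (pX ⁻¹' U) := hz
      exact this.ne'
    exact hπD.ne' h2
  have h2 : ∃ M, statM hF π (pX ⁻¹' EM ρ R Yp M) ≠ 0 := by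
    by_contra hcon
    push Not at hcon
    apply h1
    rw [hU, Set.preimage_iUnion]
    exact measure_iUnion_null hcon
  obtain ⟨M, hM⟩ := h2
  have h3 : 0 < statM hF π (pX ⁻¹' EM ρ R Yp (M + 2)) :=
    (pos_iff_ne_zero.2 hM).trans_le (measure_mono (Set.preimage_mono (EM_mono ρ R Yp (by omega))))
  obtain ⟨c, hc, h4⟩ := freq_lemma hF hH hψ π hπ _ (measurable_pX (measurableSet_EM hρ R Yp (M + 2))) h3
  refine ⟨M + 2, by omega, c, hc, fun z => (h4 z).mono fun ω hω => ?_⟩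
  intro K
  obtain ⟨N, hN⟩ := hω K
  exact ⟨N, fun n hn => hN n hn⟩

end Freq

section Contract
set_option linter.unusedSectionVars false

variable {X : Type*} [MeasurableSpace X] {Y : Type*} [Fintype Y] [DecidableEq Y]
  [MeasurableSpace Y] [MeasurableSingletonClass Y]
variable {κ : Kernel (X × Y) (X × Y)} {Pz : X × Y → Measure (ℕ → X × Y)}

lemma block_contract (p : Y → Y → ℝ) (e : Y → ℝ) (M : ℝ) (hM : 1 ≤ M)
    (hp : ∀ i, (∀ j, p i j = 0) ∨ (∀ j, 0 ≤ p i j ∧ e j ≤ M * p i j ∧ p i j ≤ M * e j))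
    (he : ∀ j, 0 ≤ e j) (h1 hA : Y → ℝ) (hpos : ∀ j, 0 ≤ h1 j) (a b : ℝ) (hab : a ≤ b)
    (hbt : ∀ j, a * h1 j ≤ hA j ∧ hA j ≤ b * h1 j) :
    ∃ a' b', a ≤ a' ∧ b' ≤ b ∧ b' - a' = (1 - 1 / M ^ 2) * (b - a) ∧
      ∀ i, a' * ∑ j, p i j * h1 j ≤ ∑ j, p i j * hA j ∧
        ∑ j, p i j * hA j ≤ b' * ∑ j, p i j * h1 j := by
  have hM0 : 0 < M := by linarith
  set L := ∑ j, e j * h1 j with hL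
  set LA := ∑ j, e j * hA j with hLA
  have hLb : LA ≤ b * L := by
    rw [hL, hLA, Finset.mul_sum]
    refine Finset.sum_le_sum fun j _ => ?_
    nlinarith [mul_le_mul_of_nonneg_left (hbt j).2 (he j)]
  have hLa : a * L ≤ LA := by
    rw [hL, hLA, Finset.mul_sum]
    refine Finset.sum_le_sum fun j _ => ?_
    nlinarith [mul_le_mul_of_nonneg_left (hbt j).1 (he j)]
  have hL0 : 0 ≤ L := Finset.sum_nonneg fun j _ => mul_nonneg (he j) (hpos j)
  obtain ⟨θ, hθa, hθb, hθ⟩ : ∃ θ, a ≤ θ ∧ θ ≤ b ∧ LA = θ * L := by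
    rcases hL0.eq_or_lt with h | h
    · refine ⟨a, le_rfl, hab, ?_⟩
      rw [← h] at hLb hLa ⊢; linarith
    · exact ⟨LA / L, (le_div_iff₀ h).2 hLa, (div_le_iff₀ h).2 hLb, by field_simp⟩
  refine ⟨a + (θ - a) / M ^ 2, b - (b - θ) / M ^ 2, ?_, ?_, by ring, fun i => ?_⟩
  · have : 0 ≤ (θ - a) / M ^ 2 := div_nonneg (by linarith) (by positivity)
    linarith
  · have : 0 ≤ (b - θ) / M ^ 2 := div_nonneg (by linarith) (by positivity)
    linarith
  rcases hp i with h0 | hpi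
  · simp [h0]
  set S := ∑ j, p i j * h1 j with hS
  set SA := ∑ j, p i j * hA j with hSA
  have hSM : S ≤ M * L := by
    rw [hS, hL, Finset.mul_sum]
    refine Finset.sum_le_sum fun j _ => ?_
    nlinarith [mul_le_mul_of_nonneg_right (hpi j).2.2 (hpos j)]
  have hub : b * L - LA ≤ M * (b * S - SA) := by
    have e1 : b * L - LA = ∑ j, e j * (b * h1 j - hA j) := by
      rw [hL, hLA, Finset.mul_sum, ← Finset.sum_sub_distrib]
      exact Finset.sum_congr rfl fun j _ => by ring
    have e2 : M * (b * S - SA) = ∑ j, (M * p i j) * (b * h1 j - hA j) := by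
      rw [hS, hSA, Finset.mul_sum, ← Finset.sum_sub_distrib, Finset.mul_sum]
      exact Finset.sum_congr rfl fun j _ => by ring
    rw [e1, e2]
    refine Finset.sum_le_sum fun j _ => ?_
    exact mul_le_mul_of_nonneg_right (hpi j).2.1 (by linarith [(hbt j).2])
  have hlb : LA - a * L ≤ M * (SA - a * S) := by
    have e1 : LA - a * L = ∑ j, e j * (hA j - a * h1 j) := by
      rw [hL, hLA, Finset.mul_sum, ← Finset.sum_sub_distrib]
      exact Finset.sum_congr rfl fun j _ => by ring
    have e2 : M * (SA - a * S) = ∑ j, (M * p i j) * (hA j - a * h1 j) := by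
      rw [hS, hSA, Finset.mul_sum, ← Finset.sum_sub_distrib, Finset.mul_sum]
      exact Finset.sum_congr rfl fun j _ => by ring
    rw [e1, e2]
    refine Finset.sum_le_sum fun j _ => ?_
    exact mul_le_mul_of_nonneg_right (hpi j).2.1 (by linarith [(hbt j).1])
  rw [hθ] at hub hlb
  constructor
  · have h5 : (θ - a) * S ≤ M ^ 2 * (SA - a * S) := by
      nlinarith [mul_le_mul_of_nonneg_left hSM (sub_nonneg.2 hθa), mul_le_mul_of_nonneg_left hlb hM0.le]
    have h6 : (θ - a) * S / M ^ 2 ≤ SA - a * S := (div_le_iff₀ (by positivity)).2 (by linarith)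
    have : (a + (θ - a) / M ^ 2) * S = a * S + (θ - a) * S / M ^ 2 := by ring
    linarith
  · have h5 : (b - θ) * S ≤ M ^ 2 * (b * S - SA) := by
      nlinarith [mul_le_mul_of_nonneg_left hSM (sub_nonneg.2 hθb), mul_le_mul_of_nonneg_left hub hM0.le]
    have h6 : (b - θ) * S / M ^ 2 ≤ b * S - SA := (div_le_iff₀ (by positivity)).2 (by linarith)
    have : (b - (b - θ) / M ^ 2) * S = b * S - (b - θ) * S / M ^ 2 := by ring
    linarith

lemma consPre_sh {α : Type*} (u : ℕ) (A : Set (ℕ → α)) (i : α) :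
    consPre i (sh (u + 1) ⁻¹' A) = sh u ⁻¹' A := by
  ext y
  show sh (u + 1) (scons i y) ∈ A ↔ sh u y ∈ A
  rw [sh_succ_scons]

lemma HH_shift_one (ρ : X × Y → X × Y → ℝ≥0) (A : Set (ℕ → Y)) (m u : ℕ) (x : ℕ → X) (i : Y) :
    HH ρ Pz (m + 1) (sh (u + 1) ⁻¹' A) x i
      = ∑ j, ρ (x 1, j) (x 0, i) * HH ρ Pz m (sh u ⁻¹' A) (sh 1 x) j := by
  simp only [HH, consPre_sh]

lemma HH_shift (ρ : X × Y → X × Y → ℝ≥0) (A : Set (ℕ → Y)) (m u r : ℕ) : ∀ (x : ℕ → X) (i : Y),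
    HH ρ Pz (m + r) (sh (u + r) ⁻¹' A) x i
      = ∑ j, pp ρ r x i j * HH ρ Pz m (sh u ⁻¹' A) (sh r x) j := by
  induction r with
  | zero => intro x i; simp [pp]
  | succ r ih =>
    intro x i
    rw [← add_assoc, ← add_assoc, HH_shift_one]
    simp_rw [ih, sh_sh, pp, Finset.mul_sum, Finset.sum_mul, ← mul_assoc]
    rw [Finset.sum_comm, Nat.add_comm 1 r]

lemma HH_compl (ρ : X × Y → X × Y → ℝ≥0) (hF : IsMarkovFamily κ Pz) (m : ℕ) :
    ∀ (A : Set (ℕ → Y)) (_ : MeasurableSet A) (x : ℕ → X) (i : Y),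
    HH ρ Pz m A x i + HH ρ Pz m Aᶜ x i = HH ρ Pz m Set.univ x i := by
  have := hF.1
  induction m with
  | zero =>
    intro A hA x i
    simp only [HH]
    rw [← ENNReal.toNNReal_add (measure_ne_top _ _) (measure_ne_top _ _), Set.preimage_compl,
      measure_add_measure_compl (measurable_pY hA)]
    rfl
  | succ m ih =>
    intro A hA x i
    have e : consPre i (Set.univ : Set (ℕ → Y)) = Set.univ := by ext; simp [consPre]
    have e' : consPre i Aᶜ = (consPre i A)ᶜ := rfl
    simp only [HH, e, e', ← ih _ (measurableSet_consPre i hA), mul_add, Finset.sum_add_distrib]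

lemma contraction (ρ : X × Y → X × Y → ℝ≥0) (hF : IsMarkovFamily κ Pz)
    {R : ℕ} (hR : 1 ≤ R) (Yp : Set (Y × Y)) (hYp : Yp = (Prod.fst '' Yp) ×ˢ (Prod.snd '' Yp))
    (M : ℕ) (hM : 2 ≤ M) (γ : ℝ) (hγ0 : 0 < γ) (hγ1 : γ ≤ 1)
    (hγ : 1 - 1 / (M : ℝ) ^ 2 ≤ γ ^ R) (A : Set (ℕ → Y)) (hA : MeasurableSet A) (u : ℕ) :
    ∀ (m : ℕ) (_ : u ≤ m) (x : ℕ → X), ∃ a b : ℝ, 0 ≤ a ∧ a ≤ b ∧ b ≤ 1 ∧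
      b - a ≤ γ ^ cnt (EM ρ R Yp M) (u + 1 - R) x ∧
      ∀ i, a * HH ρ Pz m Set.univ x i ≤ HH ρ Pz m (sh u ⁻¹' A) x i ∧
        (HH ρ Pz m (sh u ⁻¹' A) x i : ℝ) ≤ b * HH ρ Pz m Set.univ x i := by
  classical
  have hM1 : (1 : ℝ) ≤ M := by exact_mod_cast (by omega : 1 ≤ M)
  have hun : ∀ v : ℕ, sh v ⁻¹' (Set.univ : Set (ℕ → Y)) = Set.univ := fun v => rfl
  induction u using Nat.strong_induction_on with
  | _ u ih =>
  intro m hum x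
  by_cases hx : x ∈ EM ρ R Yp M ∧ R ≤ u
  · obtain ⟨hxE, hRu⟩ := hx
    obtain ⟨u', rfl⟩ : ∃ u', u = u' + R := ⟨u - R, by omega⟩
    obtain ⟨m', rfl⟩ : ∃ m', m = m' + R := ⟨m - R, by omega⟩
    obtain ⟨a, b, ha, hab, hb, hba, hbt⟩ := ih u' (by omega) m' (by omega) (sh R x)
    set e : Y → ℝ := fun j => if j ∈ Prod.snd '' Yp then 1 else 0 with he
    obtain ⟨a', b', haa, hbb, hd, hbt'⟩ := block_contract (fun i j => (pp ρ R x i j : ℝ)) e M hM1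
      (by
        intro i
        by_cases hi : i ∈ Prod.fst '' Yp
        · right
          intro j
          have hmem : (i, j) ∈ Yp ↔ j ∈ Prod.snd '' Yp := by
            conv_lhs => rw [hYp]
            exact ⟨fun h => h.2, fun h => ⟨hi, h⟩⟩
          refine ⟨NNReal.coe_nonneg _, ?_⟩
          by_cases hj : j ∈ Prod.snd '' Yp
          · have := (hxE i j).1 (hmem.2 hj)
            simp only [he, hj, if_true, mul_one]
            exact ⟨by exact_mod_cast this.1, by exact_mod_cast this.2⟩
          · have := (hxE i j).2 (fun h => hj (hmem.1 h))
            simp only [he, hj, if_false, mul_zero, this]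
            simp
        · left
          intro j
          have : (i, j) ∉ Yp := by
            rw [hYp]; exact fun h => hi h.1
          exact_mod_cast (hxE i j).2 this)
      (by intro j; simp only [he]; split_ifs <;> norm_num)
      (fun j => (HH ρ Pz m' Set.univ (sh R x) j : ℝ))
      (fun j => (HH ρ Pz m' (sh u' ⁻¹' A) (sh R x) j : ℝ)) (fun j => NNReal.coe_nonneg _)
      a b hab hbt
    have hinv : 0 ≤ 1 - 1 / (M : ℝ) ^ 2 := by
      have : 1 / (M : ℝ) ^ 2 ≤ 1 := by
        rw [div_le_one (by positivity)]
        nlinarith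
      linarith
    refine ⟨a', b', ha.trans haa, ?_, hbb.trans hb, ?_, fun i => ?_⟩
    · have : 0 ≤ b' - a' := by rw [hd]; exact mul_nonneg hinv (by linarith)
      linarith
    · rw [hd]
      calc (1 - 1 / (M : ℝ) ^ 2) * (b - a)
          ≤ γ ^ R * γ ^ cnt (EM ρ R Yp M) (u' + 1 - R) (sh R x) :=
            mul_le_mul hγ hba (by linarith) (by positivity)
        _ = γ ^ (R + cnt (EM ρ R Yp M) (u' + 1 - R) (sh R x)) := (pow_add _ _ _).symm
        _ ≤ γ ^ cnt (EM ρ R Yp M) (u' + R + 1 - R) x := by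
            refine pow_le_pow_of_le_one hγ0.le hγ1 ?_
            have e1 : u' + R + 1 - R = u' + 1 := by omega
            rw [e1]
            by_cases h : R ≤ u' + 1
            · have e2 : u' + 1 = R + (u' + 1 - R) := by omega
              conv_lhs => rw [e2]
              rw [cnt_add]
              have := cnt_le (EM ρ R Yp M) R x
              omega
            · have := cnt_le (EM ρ R Yp M) (u' + 1) x
              omega
    · have e1 := HH_shift (Pz := Pz) ρ A m' u' R x i
      have e2 := HH_shift (Pz := Pz) ρ Set.univ m' u' R x i
      rw [hun, hun] at e2
      rw [e1, e2]
      push_cast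
      exact hbt' i
  · by_cases hu : u = 0
    · subst hu
      refine ⟨0, 1, le_rfl, zero_le_one, le_rfl, ?_, fun i => ?_⟩
      · have : 0 + 1 - R = 0 := by omega
        rw [this]; simp [cnt]
      · have h1 := HH_compl ρ hF m (sh 0 ⁻¹' A) ((measurable_sh 0) hA) x i
        rw [← h1]
        push_cast
        refine ⟨by simp, ?_⟩
        have := NNReal.coe_nonneg (HH ρ Pz m (sh 0 ⁻¹' A)ᶜ x i)
        linarith
    · obtain ⟨u', rfl⟩ : ∃ u', u = u' + 1 := ⟨u - 1, by omega⟩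
      obtain ⟨m', rfl⟩ : ∃ m', m = m' + 1 := ⟨m - 1, by omega⟩
      obtain ⟨a, b, ha, hab, hb, hba, hbt⟩ := ih u' (by omega) m' (by omega) (sh 1 x)
      refine ⟨a, b, ha, hab, hb, hba.trans ?_, fun i => ?_⟩
      · refine pow_le_pow_of_le_one hγ0.le hγ1 ?_
        by_cases hRu : R ≤ u' + 1
        · have hxE : x ∉ EM ρ R Yp M := fun h => hx ⟨h, hRu⟩
          have e2 : u' + 1 + 1 - R = 1 + (u' + 1 - R) := by omega
          rw [e2, cnt_add]
          have : cnt (EM ρ R Yp M) 1 x = 0 := by simp [cnt, hxE]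
          omega
        · have e2 : u' + 1 + 1 - R = 0 := by omega
          rw [e2]; simp [cnt]
      · have e1 := HH_shift_one (Pz := Pz) ρ A m' u' x i
        have e2 := HH_shift_one (Pz := Pz) ρ Set.univ m' u' x i
        rw [hun, hun] at e2
        rw [e1, e2]
        push_cast
        rw [Finset.mul_sum, Finset.mul_sum]
        constructor
        · refine Finset.sum_le_sum fun j _ => ?_
          have := mul_le_mul_of_nonneg_left (hbt j).1 (NNReal.coe_nonneg (ρ (x 1, j) (x 0, i)))
          linarith
        · refine Finset.sum_le_sum fun j _ => ?_
          have := mul_le_mul_of_nonneg_left (hbt j).2 (NNReal.coe_nonneg (ρ (x 1, j) (x 0, i)))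
          linarith

end Contract

section CondBound
set_option linter.unusedSectionVars false

lemma tv_of_dense {W : Type*} [mW : MeasurableSpace W] (μ₁ μ₂ : Measure W) [IsFiniteMeasure μ₁]
    [IsFiniteMeasure μ₂] (𝒜 : Set (Set W)) (h𝒜 : IsSetAlgebra 𝒜)
    (hgen : mW = MeasurableSpace.generateFrom 𝒜) (ε : ℝ≥0∞)
    (h1 : ∀ A ∈ 𝒜, μ₁ A ≤ μ₂ A + ε) (h2 : ∀ A ∈ 𝒜, μ₂ A ≤ μ₁ A + ε) :
    tvDistM μ₁ μ₂ ≤ 2 * ε := by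
  have hd := Measure.MeasureDense.of_generateFrom_isSetAlgebra_finite (μ₁ + μ₂) h𝒜 hgen
  have key : ∀ (ν₁ ν₂ : Measure W), ν₁ ≤ μ₁ + μ₂ → ν₂ ≤ μ₁ + μ₂ →
      (∀ A ∈ 𝒜, ν₁ A ≤ ν₂ A + ε) → ∀ A, MeasurableSet A → ν₁ A ≤ ν₂ A + ε := by
    intro ν₁ ν₂ hν1 hν2 h A hA
    refine ENNReal.le_of_forall_pos_le_add fun δ hδ _ => ?_
    obtain ⟨B, hB, hAB⟩ := hd.approx A hA (measure_ne_top _ _) (δ / 2) (by positivity)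
    have e1 : ν₁ A ≤ ν₁ B + ENNReal.ofReal (δ / 2) := by
      calc ν₁ A ≤ ν₁ (B ∪ symmDiff A B) := measure_mono fun x hx => by
            by_cases hxB : x ∈ B
            · exact Or.inl hxB
            · exact Or.inr (Or.inl ⟨hx, hxB⟩)
        _ ≤ ν₁ B + ν₁ (symmDiff A B) := measure_union_le _ _
        _ ≤ _ := by gcongr; exact (hν1 _).trans hAB.le
    have e2 : ν₂ B ≤ ν₂ A + ENNReal.ofReal (δ / 2) := by
      calc ν₂ B ≤ ν₂ (A ∪ symmDiff A B) := measure_mono fun x hx => by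
            by_cases hxB : x ∈ A
            · exact Or.inl hxB
            · exact Or.inr (Or.inr ⟨hx, hxB⟩)
        _ ≤ ν₂ A + ν₂ (symmDiff A B) := measure_union_le _ _
        _ ≤ _ := by gcongr; exact (hν2 _).trans hAB.le
    have e3 : ENNReal.ofReal (δ / 2) + ENNReal.ofReal (δ / 2) = δ := by
      rw [← ENNReal.ofReal_add (by positivity) (by positivity), add_halves, ENNReal.ofReal_coe_nnreal]
    calc ν₁ A ≤ ν₁ B + ENNReal.ofReal (δ / 2) := e1
      _ ≤ (ν₂ B + ε) + ENNReal.ofReal (δ / 2) := by gcongr; exact h B hB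
      _ ≤ (ν₂ A + ENNReal.ofReal (δ / 2) + ε) + ENNReal.ofReal (δ / 2) := by gcongr
      _ = ν₂ A + ε + (ENNReal.ofReal (δ / 2) + ENNReal.ofReal (δ / 2)) := by ring
      _ = _ := by rw [e3]
  have hle1 : μ₁ ≤ μ₁ + μ₂ := Measure.le_add_right le_rfl
  have hle2 : μ₂ ≤ μ₁ + μ₂ := Measure.le_add_left le_rfl
  unfold tvDistM
  gcongr
  refine iSup₂_le fun A hA => sup_le ?_ ?_
  · exact tsub_le_iff_left.2 (key μ₁ μ₂ hle1 hle2 h1 A hA)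
  · exact tsub_le_iff_left.2 (key μ₂ μ₁ hle2 hle1 h2 A hA)

variable {X : Type*} [MeasurableSpace X] {Y : Type*} [Fintype Y] [DecidableEq Y]
  [MeasurableSpace Y] [MeasurableSingletonClass Y]
variable {κ : Kernel (X × Y) (X × Y)} {Pz : X × Y → Measure (ℕ → X × Y)}

/-- upper bound for conditional probabilities -/
noncomputable def MA (ρ : X × Y → X × Y → ℝ≥0) (Pz : X × Y → Measure (ℕ → X × Y)) (m : ℕ)
    (A : Set (ℕ → Y)) (x : ℕ → X) : ℝ≥0∞ :=
  ⨆ i, ((HH ρ Pz m A x i / HH ρ Pz m Set.univ x i : ℝ≥0) : ℝ≥0∞)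

lemma MA_congr (ρ : X × Y → X × Y → ℝ≥0) (Pz : X × Y → Measure (ℕ → X × Y)) (m : ℕ)
    (A : Set (ℕ → Y)) (x x' : ℕ → X) (h : ∀ k ≤ m, x k = x' k) :
    MA ρ Pz m A x = MA ρ Pz m A x' := by
  simp only [MA, HH_congr ρ Pz m _ x x' _ h]

lemma measurable_MA [MeasurableSingletonClass X] {ρ : X × Y → X × Y → ℝ≥0}
    (hρ : Measurable (Function.uncurry ρ)) (hF : IsMarkovFamily κ Pz) (m : ℕ)
    (A : Set (ℕ → Y)) (hA : MeasurableSet A) : Measurable (MA ρ Pz m A) := by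
  unfold MA
  exact Measurable.iSup fun i => ((measurable_HH hρ hF m A hA i).div
    (measurable_HH hρ hF m _ MeasurableSet.univ i)).coe_nnreal_ennreal

lemma HH_le_MA (ρ : X × Y → X × Y → ℝ≥0) (hF : IsMarkovFamily κ Pz) (m : ℕ)
    (A : Set (ℕ → Y)) (hA : MeasurableSet A) (x : ℕ → X) (i : Y) :
    (HH ρ Pz m A x i : ℝ≥0∞) ≤ MA ρ Pz m A x * HH ρ Pz m Set.univ x i := by
  have h1 := HH_compl ρ hF m A hA x i
  have h2 : HH ρ Pz m A x i ≤ HH ρ Pz m Set.univ x i := by rw [← h1]; exact le_self_add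
  have h3 : ((HH ρ Pz m A x i / HH ρ Pz m Set.univ x i : ℝ≥0) : ℝ≥0∞) ≤ MA ρ Pz m A x :=
    le_iSup (fun i => ((HH ρ Pz m A x i / HH ρ Pz m Set.univ x i : ℝ≥0) : ℝ≥0∞)) i
  refine le_trans ?_ (mul_le_mul_left h3 _)
  rw [← ENNReal.coe_mul, ENNReal.coe_le_coe]
  by_cases h0 : HH ρ Pz m Set.univ x i = 0
  · rw [h0] at h2 ⊢
    simpa using h2
  · rw [div_mul_cancel₀ _ h0]

lemma MA_le (ρ : X × Y → X × Y → ℝ≥0) (m : ℕ)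
    (A : Set (ℕ → Y)) (x : ℕ → X) (b : ℝ) (hb : 0 ≤ b)
    (h : ∀ i, (HH ρ Pz m A x i : ℝ) ≤ b * HH ρ Pz m Set.univ x i) :
    MA ρ Pz m A x ≤ ENNReal.ofReal b := by
  refine iSup_le fun i => ?_
  rw [← ENNReal.ofReal_coe_nnreal]
  refine ENNReal.ofReal_le_ofReal ?_
  push_cast
  exact div_le_of_le_mul₀ (NNReal.coe_nonneg _) hb (h i)

variable {Ω : Type*} [MeasurableSpace Ω]

/-- glue past and future observations -/
def glue (l s n : ℕ) (p : ℕ → X × Y) (x : ℕ → X) : Fin (n + 1 - l) → X :=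
  fun i => if l + (i : ℕ) < s then (p (l + i)).1 else x (l + i - s)

lemma measurable_glue (l s n : ℕ) :
    Measurable (fun r : (ℕ → X × Y) × (ℕ → X) => glue l s n r.1 r.2) := by
  refine measurable_pi_lambda _ fun i => ?_
  unfold glue
  split_ifs with h
  · exact measurable_fst.comp ((measurable_pi_apply _).comp measurable_fst)
  · exact (measurable_pi_apply _).comp measurable_snd

lemma joint_bound [MeasurableSingletonClass X] {ρ : X × Y → X × Y → ℝ≥0}
    (hρ : Measurable (Function.uncurry ρ))
    (μ : Measure X) [SigmaFinite μ] (hF : IsMarkovFamily κ Pz)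
    (hκ : ∀ z, κ z = (μ.prod Measure.count).withDensity (fun z' => (ρ z' z : ℝ≥0∞)))
    (P : Measure Ω) [IsProbabilityMeasure P] (Z : ℕ → Ω → X × Y) (hZ : IsMarkovChain P Z κ)
    (l s n : ℕ) (hls : l ≤ s) (hsn : s ≤ n) (A : Set (ℕ → Y)) (hA : MeasurableSet A)
    (B : Set (Fin (n + 1 - l) → X)) (hB : MeasurableSet B) :
    P (obsVec Z l n ⁻¹' B ∩ tailY Z s ⁻¹' A)
      ≤ ∫⁻ ω in obsVec Z l n ⁻¹' B, MA ρ Pz (n - s) A (obsTail Z s ω) ∂P := by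
  have hVm : Measurable (obsVec Z l n) :=
    measurable_pi_lambda _ fun i => measurable_fst.comp (hZ.1 _)
  have hTm : Measurable (tailY Z s) :=
    measurable_pi_lambda _ fun i => measurable_snd.comp (hZ.1 _)
  have hglue : ∀ ω, glue l s n (pastP Z s ω) (obsTail Z s ω) = obsVec Z l n ω := by
    intro ω
    funext i
    simp only [glue, pastP, obsTail, obsVec]
    split_ifs with h
    · rw [min_eq_left h.le]
    · rw [show s + (l + (i : ℕ) - s) = l + i by omega]
  have hMm := measurable_MA hρ hF (n - s) A hA
  have hB1 : Measurable (B.indicator (1 : (Fin (n + 1 - l) → X) → ℝ≥0∞)) :=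
    measurable_one.indicator hB
  have hA1 : Measurable (A.indicator (1 : (ℕ → Y) → ℝ≥0∞)) := measurable_one.indicator hA
  have hgp : Measurable (fun r : (ℕ → X × Y) × (ℕ → X × Y) => glue l s n r.1 (pX r.2)) :=
    (measurable_glue l s n).comp (measurable_fst.prodMk (measurable_pX.comp measurable_snd))
  have j1 := markov_joint hF hZ s
    (fun p f => B.indicator 1 (glue l s n p (pX f)) * A.indicator 1 (pY f))
    ((hB1.comp hgp).mul (hA1.comp (measurable_pY.comp measurable_snd)))
  have j2 := markov_joint hF hZ s
    (fun p f => B.indicator 1 (glue l s n p (pX f)) * MA ρ Pz (n - s) A (pX f))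
    ((hB1.comp hgp).mul (hMm.comp (measurable_pX.comp measurable_snd)))
  have hpX : ∀ ω, pX (fun k => Z (s + k) ω) = obsTail Z s ω := fun ω => rfl
  have hpY : ∀ ω, pY (fun k => Z (s + k) ω) = tailY Z s ω := fun ω => rfl
  have L1 : P (obsVec Z l n ⁻¹' B ∩ tailY Z s ⁻¹' A) = ∫⁻ ω,
      B.indicator (1 : (Fin (n + 1 - l) → X) → ℝ≥0∞)
        (glue l s n (pastP Z s ω) (pX (fun k => Z (s + k) ω)))
        * A.indicator (1 : (ℕ → Y) → ℝ≥0∞) (pY (fun k => Z (s + k) ω)) ∂P := by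
    rw [← lintegral_indicator_one ((hVm hB).inter (hTm hA))]
    refine lintegral_congr fun ω => ?_
    rw [hpX, hpY, hglue, Set.inter_indicator_one]
    rfl
  have L2 : ∫⁻ ω in obsVec Z l n ⁻¹' B, MA ρ Pz (n - s) A (obsTail Z s ω) ∂P = ∫⁻ ω,
      B.indicator (1 : (Fin (n + 1 - l) → X) → ℝ≥0∞)
        (glue l s n (pastP Z s ω) (pX (fun k => Z (s + k) ω)))
        * MA ρ Pz (n - s) A (pX (fun k => Z (s + k) ω)) ∂P := by
    rw [← lintegral_indicator (hVm hB)]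
    refine lintegral_congr fun ω => ?_
    rw [hpX, hglue]
    by_cases h : obsVec Z l n ω ∈ B
    · rw [Set.indicator_of_mem (show ω ∈ obsVec Z l n ⁻¹' B from h), Set.indicator_of_mem h]
      simp
    · rw [Set.indicator_of_notMem (show ω ∉ obsVec Z l n ⁻¹' B from h), Set.indicator_of_notMem h]
      simp
  rw [L1, L2, j1, j2]
  refine lintegral_mono fun ω => ?_
  rcases hz : Z s ω with ⟨x0, i⟩
  set p := pastP Z s ω with hp
  have hgd : ∀ x x' : ℕ → X, (∀ k ≤ n - s, x k = x' k) →
      B.indicator (1 : (Fin (n + 1 - l) → X) → ℝ≥0∞) (glue l s n p x)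
        = B.indicator 1 (glue l s n p x') := by
    intro x x' h
    congr 1
    funext k
    simp only [glue]
    split_ifs with hk
    · rfl
    · exact h _ (by have := k.2; omega)
  have hgm : Measurable (fun x : ℕ → X =>
      B.indicator (1 : (Fin (n + 1 - l) → X) → ℝ≥0∞) (glue l s n p x)) :=
    hB1.comp ((measurable_glue l s n).comp (measurable_const.prodMk measurable_id))
  have p1 := path_formula hρ μ hF hκ x0 (n - s) _ hgm hgd A hA x0 i
  have p2 := path_formula hρ μ hF hκ x0 (n - s)
    (fun x => B.indicator (1 : (Fin (n + 1 - l) → X) → ℝ≥0∞) (glue l s n p x)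
      * MA ρ Pz (n - s) A x) (hgm.mul hMm)
    (fun x x' h => by
      show _ * _ = _ * _
      rw [hgd x x' h, MA_congr ρ Pz (n - s) A x x' h]) Set.univ MeasurableSet.univ x0 i
  simp only [Set.indicator_univ, Pi.one_apply, mul_one] at p2
  show ∫⁻ ω', B.indicator 1 (glue l s n p (pX ω')) * A.indicator 1 (pY ω') ∂(Pz (x0, i))
    ≤ ∫⁻ ω', B.indicator 1 (glue l s n p (pX ω')) * MA ρ Pz (n - s) A (pX ω') ∂(Pz (x0, i))
  rw [p1, p2]
  refine lintegral_mono fun w => ?_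
  show _ ≤ _ * _ * _
  rw [mul_assoc]
  gcongr
  exact HH_le_MA ρ hF (n - s) A hA _ i

lemma cond_bound [MeasurableSingletonClass X] [Nonempty Y] {ρ : X × Y → X × Y → ℝ≥0}
    (hρ : Measurable (Function.uncurry ρ))
    (μ : Measure X) [SigmaFinite μ] (hF : IsMarkovFamily κ Pz)
    (hκ : ∀ z, κ z = (μ.prod Measure.count).withDensity (fun z' => (ρ z' z : ℝ≥0∞)))
    (P : Measure Ω) [IsProbabilityMeasure P] (Z : ℕ → Ω → X × Y) (hZ : IsMarkovChain P Z κ) (d : X)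
    (l s t n : ℕ) (hls : l ≤ s) (hst : s ≤ t) (htn : t ≤ n) (A : Set (ℕ → Y))
    (hA : MeasurableSet A) :
    ∀ᵐ ω ∂P, condLawTail P Z t l n ω A
      ≤ MA ρ Pz (n - s) (sh (t - s) ⁻¹' A) (obsTail Z s ω) := by
  have hVm : Measurable (obsVec Z l n) :=
    measurable_pi_lambda _ fun i => measurable_fst.comp (hZ.1 _)
  have hTm : Measurable (tailY Z t) :=
    measurable_pi_lambda _ fun i => measurable_snd.comp (hZ.1 _)
  have hA' : MeasurableSet (sh (t - s) ⁻¹' A) := (measurable_sh (t - s)) hA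
  set g : (Fin (n + 1 - l) → X) → ℝ≥0∞ :=
    fun v => MA ρ Pz (n - s) (sh (t - s) ⁻¹' A) (sh (s - l) (vext d v)) with hg
  have hgm : Measurable g := (measurable_MA hρ hF (n - s) _ hA').comp
    ((measurable_sh (s - l)).comp (measurable_vext d))
  have hgV : ∀ ω, g (obsVec Z l n ω)
      = MA ρ Pz (n - s) (sh (t - s) ⁻¹' A) (obsTail Z s ω) := by
    intro ω
    refine MA_congr ρ Pz (n - s) _ _ _ fun k hk => ?_
    simp only [sh_apply, vext]
    rw [dif_pos (by omega)]
    simp only [obsVec, obsTail]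
    rw [show l + (s - l + k) = s + k by omega]
  have hset : tailY Z t ⁻¹' A = tailY Z s ⁻¹' (sh (t - s) ⁻¹' A) := by
    ext ω
    show tailY Z t ω ∈ A ↔ sh (t - s) (tailY Z s ω) ∈ A
    have : sh (t - s) (tailY Z s ω) = tailY Z t ω := by
      funext k
      simp only [sh_apply, tailY]
      rw [show s + (t - s + k) = t + k by omega]
    rw [this]
  have hae : (fun v => condDistrib (tailY Z t) (obsVec Z l n) P v A)
      ≤ᵐ[P.map (obsVec Z l n)] g := by
    refine ae_le_of_forall_setLIntegral_le_of_sigmaFinite (Kernel.measurable_coe _ hA)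
      fun B hB _ => ?_
    rw [setLIntegral_map hB (Kernel.measurable_coe _ hA) hVm, setLIntegral_map hB hgm hVm,
      setLIntegral_preimage_condDistrib hVm hTm.aemeasurable hA hB, hset]
    simp_rw [hgV]
    exact joint_bound hρ μ hF hκ P Z hZ l s n hls (hst.trans htn) _ hA' B hB
  have := ae_of_ae_map hVm.aemeasurable hae
  filter_upwards [this] with ω hω
  rw [← hgV]
  exact hω

end CondBound

section TVBound
set_option linter.unusedSectionVars false
variable {X : Type*} [MeasurableSpace X] {Y : Type*} [Fintype Y] [DecidableEq Y]
  [MeasurableSpace Y] [MeasurableSingletonClass Y]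
variable {κ : Kernel (X × Y) (X × Y)} {Pz : X × Y → Measure (ℕ → X × Y)}
variable {Ω : Type*} [MeasurableSpace Ω]

lemma two_sided {W : Type*} [MeasurableSpace W] (μ₁ μ₂ : Measure W) [IsProbabilityMeasure μ₁]
    [IsProbabilityMeasure μ₂] (A : Set W) (hA : MeasurableSet A) (a b e : ℝ) (ha : 0 ≤ a)
    (hab : a ≤ b) (hb : b ≤ 1) (he : b - a ≤ e)
    (h1 : μ₁ A ≤ ENNReal.ofReal b) (h2 : μ₂ Aᶜ ≤ ENNReal.ofReal (1 - a)) :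
    μ₁ A ≤ μ₂ A + ENNReal.ofReal e := by
  have h3 : μ₂ A + μ₂ Aᶜ = 1 := by rw [measure_add_measure_compl hA, measure_univ]
  have h4 : ENNReal.ofReal a ≤ μ₂ A := by
    have h5 : ENNReal.ofReal a + ENNReal.ofReal (1 - a) = 1 := by
      rw [← ENNReal.ofReal_add ha (by linarith)]; simp
    have h6 : ENNReal.ofReal a + ENNReal.ofReal (1 - a) ≤ μ₂ A + ENNReal.ofReal (1 - a) := by
      rw [h5, ← h3]; gcongr
    exact (ENNReal.add_le_add_iff_right ENNReal.ofReal_ne_top).1 h6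
  calc μ₁ A ≤ ENNReal.ofReal b := h1
    _ ≤ ENNReal.ofReal (a + e) := ENNReal.ofReal_le_ofReal (by linarith)
    _ = ENNReal.ofReal a + ENNReal.ofReal e := ENNReal.ofReal_add ha (by linarith)
    _ ≤ _ := by gcongr

lemma tv_bound [MeasurableSingletonClass X] [Nonempty Y] {ρ : X × Y → X × Y → ℝ≥0}
    (hρ : Measurable (Function.uncurry ρ))
    (μ : Measure X) [SigmaFinite μ] (hF : IsMarkovFamily κ Pz)
    (hκ : ∀ z, κ z = (μ.prod Measure.count).withDensity (fun z' => (ρ z' z : ℝ≥0∞)))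
    (P : Measure Ω) [IsProbabilityMeasure P] (Z : ℕ → Ω → X × Y) (hZ : IsMarkovChain P Z κ) (d : X)
    {R : ℕ} (hR : 1 ≤ R) (Yp : Set (Y × Y)) (hYp : Yp = (Prod.fst '' Yp) ×ˢ (Prod.snd '' Yp))
    (M : ℕ) (hM : 2 ≤ M) (γ : ℝ) (hγ0 : 0 < γ) (hγ1 : γ ≤ 1)
    (hγ : 1 - 1 / (M : ℝ) ^ 2 ≤ γ ^ R)
    (l s t : ℕ) (hls : l ≤ s) (hst : s ≤ t) :
    ∀ᵐ ω ∂P, ∀ n, t ≤ n →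
      tvDistM (condLawTail P Z t l n ω) (condLawTail P Z t s n ω)
        ≤ 2 * ENNReal.ofReal (γ ^ cnt (EM ρ R Yp M) (t - s + 1 - R) (obsTail Z s ω)) := by
  set 𝒜 : Set (Set (ℕ → Y)) :=
    generateSetAlgebra (MeasurableSpace.countableGeneratingSet (ℕ → Y)) with h𝒜
  have hgen : (inferInstance : MeasurableSpace (ℕ → Y)) = MeasurableSpace.generateFrom 𝒜 := by
    rw [h𝒜, generateFrom_generateSetAlgebra_eq,
      MeasurableSpace.generateFrom_countableGeneratingSet]
  have hmeas : ∀ A ∈ 𝒜, MeasurableSet A := fun A hA => by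
    have h : MeasurableSet[MeasurableSpace.generateFrom 𝒜] A :=
      MeasurableSpace.measurableSet_generateFrom hA
    rw [← hgen] at h
    exact h
  have hcount : 𝒜.Countable :=
    countable_generateSetAlgebra MeasurableSpace.countable_countableGeneratingSet
  have hall : ∀ᵐ ω ∂P, ∀ A ∈ 𝒜, ∀ n, t ≤ n → ∀ l' ∈ ({l, s} : Set ℕ),
      condLawTail P Z t l' n ω A
        ≤ MA ρ Pz (n - s) (sh (t - s) ⁻¹' A) (obsTail Z s ω) ∧
      condLawTail P Z t l' n ω Aᶜ
        ≤ MA ρ Pz (n - s) (sh (t - s) ⁻¹' Aᶜ) (obsTail Z s ω) := by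
    rw [ae_ball_iff hcount]
    intro A hA
    rw [ae_all_iff]
    intro n
    by_cases htn : t ≤ n
    · have hb : ∀ l' ≤ s, ∀ᵐ ω ∂P, condLawTail P Z t l' n ω A
          ≤ MA ρ Pz (n - s) (sh (t - s) ⁻¹' A) (obsTail Z s ω) ∧
        condLawTail P Z t l' n ω Aᶜ
          ≤ MA ρ Pz (n - s) (sh (t - s) ⁻¹' Aᶜ) (obsTail Z s ω) := fun l' hl' =>
        (cond_bound hρ μ hF hκ P Z hZ d l' s t n hl' hst htn A (hmeas A hA)).and
          (cond_bound hρ μ hF hκ P Z hZ d l' s t n hl' hst htn Aᶜ (hmeas A hA).compl)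
      filter_upwards [hb l hls, hb s le_rfl] with ω h1 h2 _ l' hl'
      rcases hl' with rfl | rfl
      · exact h1
      · exact h2
    · exact Filter.Eventually.of_forall fun ω h => absurd h htn
  filter_upwards [hall] with ω hω n htn
  set x := obsTail Z s ω with hx
  have hp1 : IsProbabilityMeasure (condLawTail P Z t l n ω) := by
    unfold condLawTail; infer_instance
  have hp2 : IsProbabilityMeasure (condLawTail P Z t s n ω) := by
    unfold condLawTail; infer_instance
  have key : ∀ A ∈ 𝒜, ∃ a b : ℝ, 0 ≤ a ∧ a ≤ b ∧ b ≤ 1 ∧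
      b - a ≤ γ ^ cnt (EM ρ R Yp M) (t - s + 1 - R) x ∧
      MA ρ Pz (n - s) (sh (t - s) ⁻¹' A) x ≤ ENNReal.ofReal b ∧
      MA ρ Pz (n - s) (sh (t - s) ⁻¹' Aᶜ) x ≤ ENNReal.ofReal (1 - a) := by
    intro A hA
    obtain ⟨a, b, ha, hab, hb, hba, hbt⟩ := contraction ρ hF hR Yp hYp M hM γ hγ0 hγ1 hγ A
      (hmeas A hA) (t - s) (n - s) (by omega) x
    refine ⟨a, b, ha, hab, hb, hba, MA_le ρ _ _ x b (ha.trans hab) fun i => (hbt i).2,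
      MA_le ρ _ _ x (1 - a) (by linarith) fun i => ?_⟩
    have hc := HH_compl ρ hF (n - s) (sh (t - s) ⁻¹' A)
      ((measurable_sh (t - s)) (hmeas A hA)) x i
    rw [← Set.preimage_compl] at hc
    have hc' : (HH ρ Pz (n - s) (sh (t - s) ⁻¹' A) x i : ℝ)
      + HH ρ Pz (n - s) (sh (t - s) ⁻¹' Aᶜ) x i = HH ρ Pz (n - s) Set.univ x i := by
      exact_mod_cast congrArg NNReal.toReal hc
    have := (hbt i).1
    nlinarith
  refine tv_of_dense _ _ 𝒜 isSetAlgebra_generateSetAlgebra hgen _ ?_ ?_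
  · intro A hA
    obtain ⟨a, b, ha, hab, hb, hba, k1, k2⟩ := key A hA
    exact two_sided _ _ A (hmeas A hA) a b _ ha hab hb hba
      ((hω A hA n htn l (by simp)).1.trans k1) ((hω A hA n htn s (by simp)).2.trans k2)
  · intro A hA
    obtain ⟨a, b, ha, hab, hb, hba, k1, k2⟩ := key A hA
    exact two_sided _ _ A (hmeas A hA) a b _ ha hab hb hba
      ((hω A hA n htn s (by simp)).1.trans k1) ((hω A hA n htn l (by simp)).2.trans k2)

/-- the ratio between the contraction coefficient and its exponential rate -/
noncomputable def Drat (B : Set (ℕ → X)) (R : ℕ) (γ α : ℝ) (u : ℕ) (x : ℕ → X) : ℝ :=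
  2 * γ ^ cnt B (u + 1 - R) x * (α⁻¹) ^ u

lemma measurable_Drat {B : Set (ℕ → X)} (hB : MeasurableSet B) (R : ℕ) (γ α : ℝ) (u : ℕ) :
    Measurable (Drat B R γ α u) := by
  unfold Drat
  exact (((measurable_from_top (f := fun k : ℕ => γ ^ k)).comp
    (measurable_cnt hB (u + 1 - R))).const_mul 2).mul_const _

lemma Drat_bdd (B : Set (ℕ → X)) (R : ℕ) (γ c : ℝ) (hγ0 : 0 < γ) (hγ1 : γ < 1) (hc : 0 < c)
    (x : ℕ → X) (hx : x ∈ goodSet B c) :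
    ∃ L : ℝ, ∀ u, Drat B R γ (γ ^ c) u x ≤ L := by
  obtain ⟨N, hN⟩ := hx 0
  set α := γ ^ c with hα
  have hα0 : 0 < α := Real.rpow_pos_of_pos hγ0 c
  have hα1 : α < 1 := Real.rpow_lt_one hγ0.le hγ1 hc
  have hinv : 1 ≤ α⁻¹ := (one_le_inv₀ hα0).2 hα1.le
  refine ⟨2 * (α⁻¹) ^ (N + R), fun u => ?_⟩
  unfold Drat
  by_cases hu : N ≤ u + 1 - R
  · have h1 := hN _ hu
    set v := u + 1 - R with hv
    have h2 : γ ^ cnt B v x ≤ α ^ v := by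
      rw [← Real.rpow_natCast γ, ← Real.rpow_natCast α, hα, ← Real.rpow_mul hγ0.le]
      exact Real.rpow_le_rpow_of_exponent_ge hγ0 hγ1.le (by simpa using h1)
    have h3 : (α⁻¹) ^ u ≤ (α⁻¹) ^ (v + (N + R)) := pow_le_pow_right₀ hinv (by omega)
    have h4 : α ^ v * (α⁻¹) ^ v = 1 := by
      rw [← mul_pow, mul_inv_cancel₀ hα0.ne', one_pow]
    calc 2 * γ ^ cnt B v x * α⁻¹ ^ u ≤ 2 * α ^ v * (α⁻¹) ^ (v + (N + R)) := by gcongr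
      _ = 2 * (α ^ v * (α⁻¹) ^ v) * (α⁻¹) ^ (N + R) := by rw [pow_add]; ring
      _ = _ := by rw [h4, mul_one]
  · have h2 : γ ^ cnt B (u + 1 - R) x ≤ 1 := pow_le_one₀ hγ0.le hγ1.le
    have h3 : (α⁻¹) ^ u ≤ (α⁻¹) ^ (N + R) := pow_le_pow_right₀ hinv (by omega)
    calc 2 * γ ^ cnt B (u + 1 - R) x * α⁻¹ ^ u ≤ 2 * 1 * (α⁻¹) ^ (N + R) := by gcongr
      _ = _ := by ring

lemma good_ae [MeasurableSingletonClass X] (hF : IsMarkovFamily κ Pz)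
    (P : Measure Ω) [IsProbabilityMeasure P] (Z : ℕ → Ω → X × Y) (hZ : IsMarkovChain P Z κ)
    (G : Set (ℕ → X)) (hG : MeasurableSet G) (h : ∀ z, ∀ᵐ ω ∂(Pz z), pX ω ∈ G) (s : ℕ) :
    ∀ᵐ ω ∂P, obsTail Z s ω ∈ G := by
  have hm : MeasurableSet ((pX : (ℕ → X × Y) → ℕ → X) ⁻¹' Gᶜ) := measurable_pX hG.compl
  have hTm : Measurable (obsTail Z s) :=
    measurable_pi_lambda _ fun i => measurable_fst.comp (hZ.1 _)
  have j := markov_lintegral hF hZ s (((pX : (ℕ → X × Y) → ℕ → X) ⁻¹' Gᶜ).indicator 1)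
    (measurable_one.indicator hm)
  simp_rw [lintegral_indicator_one hm] at j
  have h0 : ∀ z, Pz z ((pX : (ℕ → X × Y) → ℕ → X) ⁻¹' Gᶜ) = 0 := fun z => h z
  simp_rw [h0, lintegral_zero] at j
  have e : ∫⁻ ω, (((pX : (ℕ → X × Y) → ℕ → X) ⁻¹' Gᶜ).indicator (1 : (ℕ → X × Y) → ℝ≥0∞))
      (fun k => Z (s + k) ω) ∂P = P (obsTail Z s ⁻¹' Gᶜ) := by
    rw [← lintegral_indicator_one (hTm hG.compl)]
    rfl
  rw [e] at j
  exact j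

lemma measurable_obsTail_from (Z : ℕ → Ω → X × Y) (s : ℕ) :
    @Measurable Ω (ℕ → X) (obsSigmaFrom Z s) _ (obsTail Z s) := by
  refine @measurable_pi_lambda _ _ _ (obsSigmaFrom Z s) _ _ fun k => ?_
  have hle : MeasurableSpace.comap (fun ω => (Z (s + k) ω).1) inferInstance
      ≤ obsSigmaFrom Z s := by
    unfold obsSigmaFrom
    exact le_iSup₂_of_le (s + k) (Set.mem_Ici.2 (Nat.le_add_right s k)) le_rfl
  exact (comap_measurable (fun ω => (Z (s + k) ω).1)).mono hle le_rfl

end TVBound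

end Helpers

/-- Corollary 1 (ii). If the PMM `Z` satisfies **A1**, **A2** and is
positive Harris, then there is `α ∈ (0,1)` such that for every `s` there is a
`σ(X_{s:∞})`-measurable random variable `C_s < ∞` with, for all `t ≥ s ≥ l`, almost surely
`sup_{n ≥ t} ‖P(Y_{t:∞} ∈ · | X_{l:n}) − P(Y_{t:∞} ∈ · | X_{s:n})‖_TV ≤ C_s α^{t−s}`. -/
theorem exponential_forgetting_of_tail_distributions
    [TopologicalSpace 𝓧] [PolishSpace 𝓧] [BorelSpace 𝓧]
    (P : Measure Ω) [IsProbabilityMeasure P]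
    (Z : ℕ → Ω → 𝓧 × 𝓨) (κ : Kernel (𝓧 × 𝓨) (𝓧 × 𝓨)) (μ : Measure 𝓧)
    (q : 𝓧 × 𝓨 → 𝓧 × 𝓨 → ℝ≥0∞) (p0 : 𝓧 × 𝓨 → ℝ≥0∞)
    (Pz : 𝓧 × 𝓨 → Measure (ℕ → 𝓧 × 𝓨)) (ψ : Measure (𝓧 × 𝓨))
    {R : ℕ} (E : Set (Fin (R + 1) → 𝓧)) (Yp : Set (𝓨 × 𝓨))
    (hPMM : IsPMM P Z κ μ q p0)
    (hA1 : Assumption1 q E Yp) (hA2 : Assumption2 κ ψ μ E Yp)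
    (hFam : IsMarkovFamily κ Pz) (hHarris : HarrisProp κ Pz ψ)
    (hPos : IsPositive κ) :
    ∃ α : ℝ, 0 < α ∧ α < 1 ∧ ∀ s : ℕ, ∃ C : Ω → ℝ,
      Measurable[obsSigmaFrom Z s] C ∧
      ∀ l t : ℕ, l ≤ s → s ≤ t → ∀ᵐ ω ∂P, ∀ n, t ≤ n →
        tvDistM (condLawTail P Z t l n ω) (condLawTail P Z t s n ω)
          ≤ ENNReal.ofReal (C ω * α ^ (t - s)) := by
  obtain ⟨-, hZ, hμ, hq, -, hκq, -⟩ := hPMM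
  obtain ⟨ρ, hρ, hκ, hqρ⟩ := exists_density q hq μ hFam hκq
  obtain ⟨M, hM, c, hc, hgood⟩ := block_freq hρ q hq μ hFam hκ hqρ E Yp hA1 ψ hA2 hHarris hPos
  obtain ⟨hR, -, -, hYp⟩ := hA1
  obtain ⟨ω0⟩ : Nonempty Ω := nonempty_of_isProbabilityMeasure P
  have hM2 : (2 : ℝ) ≤ M := by exact_mod_cast hM
  have hR1 : (1 : ℝ) ≤ R := by exact_mod_cast hR
  have hMM : (4 : ℝ) ≤ (M : ℝ) ^ 2 := by nlinarith
  set e : ℝ := 1 / ((R : ℝ) * (M : ℝ) ^ 2) with he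
  have he0 : 0 < e := by positivity
  have he1 : e ≤ 1 / 4 := by
    rw [he]
    exact one_div_le_one_div_of_le (by norm_num) (by nlinarith)
  have hRe : (R : ℝ) * e = 1 / (M : ℝ) ^ 2 := by
    rw [he]; field_simp
  set γ : ℝ := 1 - e with hγdef
  have hγ0 : 0 < γ := by linarith
  have hγ1 : γ < 1 := by linarith
  have hγR : 1 - 1 / (M : ℝ) ^ 2 ≤ γ ^ R := by
    have := one_add_mul_le_pow (a := -e) (by linarith) R
    rw [← hRe, hγdef]
    calc 1 - (R : ℝ) * e = 1 + (R : ℝ) * -e := by ring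
      _ ≤ (1 + -e) ^ R := this
      _ = _ := by rw [← sub_eq_add_neg]
  set B := EM ρ R Yp M with hBdef
  have hB : MeasurableSet B := measurableSet_EM hρ R Yp M
  set α := γ ^ c with hα
  have hα0 : 0 < α := Real.rpow_pos_of_pos hγ0 c
  have hα1 : α < 1 := Real.rpow_lt_one hγ0.le hγ1 hc
  refine ⟨α, hα0, hα1, fun s => ?_⟩
  refine ⟨fun ω => (⨆ u, ENNReal.ofReal (Drat B R γ α u (obsTail Z s ω))).toReal, ?_, ?_⟩
  · have h1 : Measurable (fun x : ℕ → 𝓧 => (⨆ u, ENNReal.ofReal (Drat B R γ α u x)).toReal) :=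
      (Measurable.iSup fun u => (measurable_Drat hB R γ α u).ennreal_ofReal).ennreal_toReal
    exact h1.comp (measurable_obsTail_from Z s)
  · intro l t hls hst
    filter_upwards [tv_bound hρ μ hFam hκ P Z hZ (Z 0 ω0).1 hR Yp hYp M hM γ hγ0 hγ1.le hγR
      l s t hls hst, good_ae hFam P Z hZ _ (measurableSet_goodSet hB c) hgood s] with ω h1 h2 n hn
    refine (h1 n hn).trans ?_
    obtain ⟨L, hL⟩ := Drat_bdd B R γ c hγ0 hγ1 hc _ h2
    set x := obsTail Z s ω with hx
    have hne : (⨆ u, ENNReal.ofReal (Drat B R γ α u x)) ≠ ∞ :=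
      ne_top_of_le_ne_top (ENNReal.ofReal_ne_top (r := L))
        (iSup_le fun u => ENNReal.ofReal_le_ofReal (hL u))
    have hle : Drat B R γ α (t - s) x
        ≤ (⨆ u, ENNReal.ofReal (Drat B R γ α u x)).toReal :=
      (ENNReal.ofReal_le_iff_le_toReal hne).1
        (le_iSup (fun u => ENNReal.ofReal (Drat B R γ α u x)) (t - s))
    have h2' : (2 : ℝ≥0∞) = ENNReal.ofReal 2 := by simp
    rw [h2', ← ENNReal.ofReal_mul (by norm_num)]
    refine ENNReal.ofReal_le_ofReal ?_
    refine le_trans (le_of_eq ?_) (mul_le_mul_of_nonneg_right hle (pow_nonneg hα0.le _))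
    unfold Drat
    rw [mul_assoc, ← mul_pow, inv_mul_cancel₀ hα0.ne', one_pow, mul_one]

end PMMPaper
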